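/- arXiv:2501.07797 — 8 statements merged into one kernel-verified Lean document; each statement's English description precedes it below -/
import Mathlib

section
/- Let m ≥ 1 be an integer and let q = p^{v_p(m)} be the p-primary factor of m (so q divides m and p does not divide m/q). For every integer i ≥ 1 that is not divisible by q, the weighted-degree-i homogeneous component of the polynomial (1 + c_1 + c_2 + ⋯ + c_p)^m in ℤ[c_1,…,c_p] has all of its coefficients divisible by p. -/
open MvPolynomial

theorem MvPolynomial.expand_zmod_pow {σ : Type*} {p : ℕ} [Fact p.Prime] (k : ℕ)
    (f : MvPolynomial σ (ZMod p)) : expand (p ^ k) f = f ^ p ^ k := by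
  induction k with
  | zero => simp
  | succ k ih => rw [pow_succ', expand_mul, ih, expand_zmod, ← pow_mul, mul_comm]

theorem Finsupp.exists_not_dvd_of_not_dvd_weight {σ : Type*} {w : σ → ℕ} {d : σ →₀ ℕ} {q : ℕ}
    (h : ¬ q ∣ Finsupp.weight w d) : ∃ j, ¬ q ∣ d j := by
  contrapose! h
  rw [Finsupp.weight_apply]
  exact Finset.dvd_sum fun j _ => (h j).mul_right (w j)

/-- If `p ^ k ∣ m`, a coefficient of `f ^ m` whose exponent vector has weight not
divisible by `p ^ k` vanishes modulo `p`. -/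
theorem MvPolynomial.dvd_coeff_pow_of_not_dvd_weight {σ : Type*} {p k m : ℕ} (hp : p.Prime)
    (hm : p ^ k ∣ m) (f : MvPolynomial σ ℤ) {w : σ → ℕ} {d : σ →₀ ℕ}
    (hd : ¬ p ^ k ∣ Finsupp.weight w d) : (p : ℤ) ∣ coeff d (f ^ m) := by
  have : Fact p.Prime := ⟨hp⟩
  obtain ⟨j, hj⟩ := Finsupp.exists_not_dvd_of_not_dvd_weight hd
  obtain ⟨n, rfl⟩ := hm
  rw [← ZMod.intCast_zmod_eq_zero_iff_dvd, ← eq_intCast (Int.castRingHom (ZMod p)),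
    ← coeff_map, map_pow, mul_comm, pow_mul, ← expand_zmod_pow]
  exact coeff_expand_of_not_dvd _ hj

/-- Let `p` be an odd prime, `m ≥ 1`, and `q = p ^ v_p(m)` the `p`-primary factor
of `m`.  Grade `ℤ[c₁,…,c_p]` by giving `cᵢ` weight `i` (here `cᵢ₊₁` is the
variable `X i`, `i : Fin p`).  For every `i ≥ 1` not divisible by `q`, every
coefficient of the weighted-degree-`i` homogeneous component of
`(1 + c₁ + ⋯ + c_p)^m` is divisible by `p`. -/
theorem chern_component_divisible (p : ℕ) (hp : p.Prime) (hodd : Odd p)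
    (m : ℕ) (hm : 1 ≤ m) (q : ℕ) (hq : q = p ^ (m.factorization p))
    (i : ℕ) (hi : 1 ≤ i) (hqi : ¬ q ∣ i) (d : Fin p →₀ ℕ) :
    (p : ℤ) ∣ coeff d
      (weightedHomogeneousComponent (fun j : Fin p => (j : ℕ) + 1) i
        (((1 + ∑ j : Fin p, X j : MvPolynomial (Fin p) ℤ)) ^ m)) := by
  classical
  rw [coeff_weightedHomogeneousComponent]
  split_ifs with h
  · subst hq h
    exact dvd_coeff_pow_of_not_dvd_weight hp (Nat.ordProj_dvd m p) _ hqi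
  · exact dvd_zero _
end

section
/- Let m ≥ 1 be an integer and let q = p^{v_p(m)} be the p-primary factor of m. Then the weighted-degree-q homogeneous component of the polynomial (1 + c_1 + c_2 + ⋯ + c_p)^m in ℤ[c_1,…,c_p] is congruent to (m choose q)·c_1^q modulo p. -/
open MvPolynomial

theorem one_add_sum_X_pow_expChar_pow {σ R : Type*} [Fintype σ] [CommSemiring R] (p : ℕ)
    [ExpChar R p] (n : ℕ) :
    (1 + ∑ i, X i : MvPolynomial σ R) ^ p ^ n = expand (p ^ n) (1 + ∑ i, X i) := by
  simp [add_pow_expChar_pow, sum_pow_char_pow]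

theorem coeff_single_one_add_sum_X_pow {σ R : Type*} [Fintype σ] [CommSemiring R] (p : ℕ)
    [ExpChar R p] (i : σ) (n m : ℕ) :
    coeff (Finsupp.single i (p ^ n)) ((1 + ∑ j, X j : MvPolynomial σ R) ^ m) =
      m.choose (p ^ n) := by
  classical
  have hp : p ^ n ≠ 0 := (pow_pos (expChar_pos R p) n).ne'
  have hS : (∑ j, X j : MvPolynomial σ R).IsHomogeneous 1 :=
    IsHomogeneous.sum _ _ _ fun j _ => isHomogeneous_X R j
  have hcoeff (k : ℕ) :
      coeff (Finsupp.single i (p ^ n)) ((∑ j, X j : MvPolynomial σ R) ^ k) =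
        if k = p ^ n then 1 else 0 := by
    split_ifs with hk
    · rw [hk, sum_pow_char_pow, coeff_sum]
      simp [coeff_X_pow, Finsupp.single_left_inj hp]
    · exact (hS.pow k).coeff_eq_zero (by simpa using Ne.symm hk)
  rw [add_comm, add_pow, coeff_sum]
  have hterm (k : ℕ) :
      coeff (Finsupp.single i (p ^ n))
          ((∑ j, X j : MvPolynomial σ R) ^ k * 1 ^ (m - k) * (m.choose k : MvPolynomial σ R)) =
        if k = p ^ n then (m.choose k : R) else 0 := by
    rw [one_pow, mul_one, mul_comm, ← map_natCast (C : R →+* MvPolynomial σ R), coeff_C_mul,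
      hcoeff, mul_ite, mul_one, mul_zero]
  simp only [hterm, Finset.sum_ite_eq', Finset.mem_range]
  split_ifs with h
  · rfl
  · rw [Nat.choose_eq_zero_of_lt (by omega), Nat.cast_zero]

theorem eq_single_zero_of_weight_eq_of_dvd {n q : ℕ} (hn : 0 < n) (hq : 0 < q)
    {d : Fin n →₀ ℕ} (hw : Finsupp.weight (fun j : Fin n => (j : ℕ) + 1) d = q)
    (hd : ∀ i, q ∣ d i) : d = Finsupp.single ⟨0, hn⟩ q := by
  rw [Finsupp.weight_eq_sum] at hw
  have hzero (i : Fin n) (hi : i ≠ ⟨0, hn⟩) : d i = 0 := by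
    by_contra hne
    have hle : d i * ((i : ℕ) + 1) ≤ q := by
      rw [← hw]
      exact Finset.single_le_sum (f := fun i : Fin n => d i • ((i : ℕ) + 1))
        (fun _ _ => Nat.zero_le _) (Finset.mem_univ i)
    have hqd : q ≤ d i := Nat.le_of_dvd (Nat.pos_of_ne_zero hne) (hd i)
    have hpos : 0 < (i : ℕ) := Nat.pos_of_ne_zero fun h => hi (Fin.ext h)
    nlinarith
  rw [Finset.sum_eq_single ⟨0, hn⟩ (fun i _ hi => by simp [hzero i hi]) (by simp)] at hw
  ext i
  by_cases hi : i = ⟨0, hn⟩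
  · subst hi
    simpa using hw
  · rw [hzero i hi, Finsupp.single_eq_of_ne hi]

/-- Let `p` be an odd prime, `m ≥ 1`, and `q = p ^ v_p(m)` the `p`-primary factor
of `m`.  Grade `ℤ[c₁,…,c_p]` by giving `cᵢ` weight `i` (here `cᵢ₊₁` is the
variable `X i`, `i : Fin p`).  The weighted-degree-`q` homogeneous component of
`(1 + c₁ + ⋯ + c_p)^m` is congruent to `(m choose q) · c₁^q` modulo `p`:
their difference has all coefficients divisible by `p`. -/
theorem chern_component_mod_p (p : ℕ) (hp : p.Prime) (hodd : Odd p)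
    (m : ℕ) (hm : 1 ≤ m) (q : ℕ) (hq : q = p ^ (m.factorization p))
    (d : Fin p →₀ ℕ) :
    (p : ℤ) ∣ coeff d
      (weightedHomogeneousComponent (fun j : Fin p => (j : ℕ) + 1) q
          (((1 + ∑ j : Fin p, X j : MvPolynomial (Fin p) ℤ)) ^ m)
        - (m.choose q : ℤ) • (X (⟨0, hp.pos⟩ : Fin p)) ^ q) := by
  have : Fact p.Prime := ⟨hp⟩
  have hqpos : 0 < q := hq ▸ pow_pos hp.pos _
  have hcast : ((coeff d ((1 + ∑ j : Fin p, X j : MvPolynomial (Fin p) ℤ) ^ m) : ℤ) : ZMod p) =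
      coeff d ((1 + ∑ j : Fin p, X j : MvPolynomial (Fin p) (ZMod p)) ^ m) := by
    rw [← eq_intCast (Int.castRingHom (ZMod p)), ← coeff_map]
    simp
  rw [← ZMod.intCast_zmod_eq_zero_iff_dvd, coeff_sub, coeff_smul,
    coeff_weightedHomogeneousComponent, coeff_X_pow]
  by_cases hd : Finsupp.single ⟨0, hp.pos⟩ q = d
  · have hw : Finsupp.weight (fun j : Fin p => (j : ℕ) + 1) d = q := by
      simp [← hd, Finsupp.weight_single]
    rw [if_pos hw, if_pos hd, Int.cast_sub, hcast, ← hd, hq, coeff_single_one_add_sum_X_pow]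
    simp
  · rw [if_neg hd, smul_zero, sub_zero]
    split_ifs with hw
    · obtain ⟨i, hi⟩ : ∃ i, ¬ q ∣ d i := by
        by_contra! h
        exact hd (eq_single_zero_of_weight_eq_of_dvd hp.pos hqpos hw h).symm
      obtain ⟨r, hr⟩ : q ∣ m := hq ▸ Nat.ordProj_dvd m p
      rw [hcast, hr, pow_mul, hq, one_add_sum_X_pow_expChar_pow, ← map_pow, ← hq]
      exact coeff_expand_of_not_dvd _ hi
    · exact Int.cast_zero
end

section
/- Assume p divides n. Let F ∈ 𝔽_p[Y_1,…,Y_n] be a polynomial such that f = F(σ_1,…,σ_n) ∈ 𝔽_p[t_1,…,t_n] is homogeneous of degree p² (as a polynomial in t_1,…,t_n) and satisfies ∇(f) = 0. If some monomial Y_p^{i_1}·Y_{2p}^{i_2}·⋯·Y_{kp}^{i_k} (a monomial involving only variables Y_j with index j divisible by p, with k ≥ 1 and i_k > 0) occurs with nonzero coefficient in F, then that monomial equals Y_p^p. -/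
open MvPolynomial

namespace MvPolynomial

section Esymm

variable {R : Type*} [CommRing R]

/-- The sum of all partial derivatives sends the elementary symmetric polynomial of degree `k + 1`
to `n - k` times the one of degree `k`. -/
lemma sum_pderiv_esymm_succ (n k : ℕ) (hk : k ≤ n) :
    ∑ i : Fin n, pderiv i (esymm (Fin n) R (k + 1)) = ((n : R) - k) • esymm (Fin n) R k := by
  have hzero (i : Fin n) (s : Finset (Fin n)) (hi : i ∉ s) :
      pderiv i (∏ j ∈ s, (X j : MvPolynomial (Fin n) R)) = 0 := by
    nontriviality R
    refine pderiv_eq_zero_of_notMem_vars fun h => ?_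
    obtain ⟨j, hj, hij⟩ := Finset.mem_biUnion.1 (vars_prod _ h)
    rw [vars_X, Finset.mem_singleton] at hij
    exact hi (hij ▸ hj)
  have hprod (i : Fin n) (s : Finset (Fin n)) :
      pderiv i (∏ j ∈ s, (X j : MvPolynomial (Fin n) R)) =
        if i ∈ s then ∏ j ∈ s.erase i, X j else 0 := by
    split_ifs with h
    · rw [← Finset.mul_prod_erase s _ h, pderiv_mul, pderiv_X_self, one_mul,
        hzero i _ (Finset.notMem_erase i s), mul_zero, add_zero]
    · exact hzero i s h
  have hcard (u : Finset (Fin n)) (hu : u ∈ Finset.powersetCard k Finset.univ) :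
      ((n : R) - k) • ∏ j ∈ u, (X j : MvPolynomial (Fin n) R) = ∑ i ∈ uᶜ, ∏ j ∈ u, X j := by
    rw [Finset.sum_const, Finset.card_compl, (Finset.mem_powersetCard.1 hu).2, Fintype.card_fin,
      ← Nat.cast_sub hk, Nat.cast_smul_eq_nsmul]
  rw [esymm, esymm, Finset.smul_sum, Finset.sum_congr rfl hcard]
  simp_rw [map_sum, hprod]
  rw [Finset.sum_comm]
  simp_rw [← Finset.sum_filter]
  rw [Finset.sum_sigma', Finset.sum_sigma']
  refine Finset.sum_bij' (fun x _ => ⟨x.1.erase x.2, x.2⟩) (fun x _ => ⟨insert x.2 x.1, x.2⟩)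
    ?_ ?_ ?_ ?_ ?_
  · rintro ⟨s, i⟩ h
    simp only [Finset.mem_sigma, Finset.mem_powersetCard, Finset.mem_filter, Finset.mem_compl,
      Finset.subset_univ, Finset.mem_univ, true_and] at h ⊢
    simp [Finset.card_erase_of_mem h.2, h.1]
  · rintro ⟨s, i⟩ h
    simp only [Finset.mem_sigma, Finset.mem_powersetCard, Finset.mem_filter, Finset.mem_compl,
      Finset.subset_univ, Finset.mem_univ, true_and] at h ⊢
    simp [Finset.card_insert_of_notMem h.2, h.1]
  · rintro ⟨s, i⟩ h
    simp only [Finset.mem_sigma, Finset.mem_filter] at h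
    simp [Finset.insert_erase h.2.2]
  · rintro ⟨s, i⟩ h
    simp only [Finset.mem_sigma, Finset.mem_compl] at h
    simp [Finset.erase_insert h.2]
  · rintro ⟨s, i⟩ -
    rfl

lemma esymm_isHomogeneous (σ : Type*) [Fintype σ] (k : ℕ) :
    (esymm σ R k).IsHomogeneous k := by
  refine IsHomogeneous.sum _ _ _ fun s hs => ?_
  simpa [(Finset.mem_powersetCard.1 hs).2] using
    IsHomogeneous.prod s (fun i => (X i : MvPolynomial σ R)) (fun _ => 1)
      fun i _ => isHomogeneous_X R i

/-- Substituting homogeneous polynomials of degrees `w i` for the variables turns weighted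
homogeneous components into homogeneous components. -/
lemma homogeneousComponent_aeval {σ τ : Type*} (w : σ → ℕ) (g : σ → MvPolynomial τ R)
    (hg : ∀ i, (g i).IsHomogeneous (w i)) (m : ℕ) (F : MvPolynomial σ R) :
    homogeneousComponent m (aeval g F) = aeval g (weightedHomogeneousComponent w m F) := by
  classical
  induction F using MvPolynomial.induction_on' with
  | add F G hF hG => simp only [map_add, hF, hG]
  | monomial s r =>
    have h1 : (aeval g (monomial s r)).IsHomogeneous (Finsupp.weight w s) := by
      rw [aeval_monomial, algebraMap_eq, Finsupp.weight_apply]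
      refine IsHomogeneous.C_mul ?_ r
      refine IsHomogeneous.prod _ _ _ fun i _ => ?_
      simpa [mul_comm] using (hg i).pow (s i)
    rw [homogeneousComponent_of_mem h1,
      weightedHomogeneousComponent_of_mem (isWeightedHomogeneous_monomial w s r rfl)]
    split_ifs <;> simp

end Esymm

section Euler

variable {R σ : Type*} [CommRing R]

/-- The derivation sending `X i` to `g i`, as a sum of partial derivatives. -/
lemma mkDerivation_eq_sum_pderiv [Fintype σ] (g : σ → MvPolynomial σ R) (F : MvPolynomial σ R) :
    mkDerivation R g F = ∑ i, g i * pderiv i F := by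
  classical
  have hsum (G : MvPolynomial σ R) :
      (∑ i, g i • pderiv i : Derivation R (MvPolynomial σ R) (MvPolynomial σ R)) G =
        ∑ i, g i * pderiv i G := by
    have h := congrFun (map_sum Derivation.coeFnAddMonoidHom (fun i => g i • pderiv i)
      Finset.univ) G
    rw [Finset.sum_apply] at h
    exact h
  have : mkDerivation R g = ∑ i, g i • pderiv i := by
    ext1 j
    simp [hsum, pderiv_X, Pi.single_apply]
  rw [this, hsum]

lemma coeff_X_mul_pderiv (i : σ) (F : MvPolynomial σ R) (d : σ →₀ ℕ) :
    coeff d (X i * pderiv i F) = d i * coeff d F := by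
  classical
  induction F using MvPolynomial.induction_on' with
  | add F G hF hG => simp only [map_add, mul_add, coeff_add, hF, hG]
  | monomial s r =>
    rw [X_mul_pderiv_monomial, coeff_smul, coeff_monomial]
    split_ifs with h <;> simp [h]

end Euler

section Blocks

variable {p n : ℕ}

/-- The derivation of `𝔽_p[Y₁, …, Yₙ]` induced, when `p ∣ n`, by the sum of the partial
derivatives through substitution of elementary symmetric polynomials. -/
noncomputable def lowering (p n : ℕ) :
    Derivation (ZMod p) (MvPolynomial (Fin n) (ZMod p)) (MvPolynomial (Fin n) (ZMod p)) :=
  mkDerivation _ fun j => (-(j : ℕ) : ZMod p) • X ⟨j - 1, (Nat.sub_le _ _).trans_lt j.2⟩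

/-- The derivation raising the indices of the variables in the `m`-th block of `p` consecutive
variables, and vanishing on the other variables. -/
noncomputable def raising (p n m : ℕ) :
    Derivation (ZMod p) (MvPolynomial (Fin n) (ZMod p)) (MvPolynomial (Fin n) (ZMod p)) :=
  mkDerivation _ fun j =>
    if h : (j : ℕ) / p = m ∧ ¬ p ∣ (j : ℕ) + 1 ∧ (j : ℕ) + 1 < n then -X ⟨j + 1, h.2.2⟩ else 0

lemma lowering_X (j : Fin n) : lowering p n (X j) =
    (-(j : ℕ) : ZMod p) • X ⟨j - 1, (Nat.sub_le _ _).trans_lt j.2⟩ :=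
  mkDerivation_X _ _ _

lemma raising_X (m : ℕ) (j : Fin n) : raising p n m (X j) =
    if h : (j : ℕ) / p = m ∧ ¬ p ∣ (j : ℕ) + 1 ∧ (j : ℕ) + 1 < n then -X ⟨j + 1, h.2.2⟩ else 0 :=
  mkDerivation_X _ _ _

lemma lowering_raising_X (hpn : p ∣ n) (m : ℕ) (j : Fin n) :
    lowering p n (raising p n m (X j)) =
      if (j : ℕ) / p = m then (((j : ℕ) : ZMod p) + 1) • X j else 0 := by
  rw [raising_X]
  by_cases hm : (j : ℕ) / p = m
  · by_cases hj : p ∣ (j : ℕ) + 1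
    · have : ((j : ℕ) : ZMod p) + 1 = 0 := by
        exact_mod_cast (ZMod.natCast_eq_zero_iff _ _).2 hj
      simp [hj, this]
    · have hlt : (j : ℕ) + 1 < n := lt_of_le_of_ne j.2 fun h => hj (hpn.trans h.symm.dvd)
      rw [dif_pos ⟨hm, hj, hlt⟩, if_pos hm, map_neg, lowering_X, ← neg_smul]
      simp
  · simp [hm]

lemma raising_lowering_X (m : ℕ) (j : Fin n) :
    raising p n m (lowering p n (X j)) =
      if (j : ℕ) / p = m then ((j : ℕ) : ZMod p) • X j else 0 := by
  rw [lowering_X, Derivation.map_smul]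
  by_cases hj : p ∣ (j : ℕ)
  · simp [(ZMod.natCast_eq_zero_iff _ _).2 hj]
  · have h0 : (j : ℕ) ≠ 0 := fun h => hj (by simp [h])
    have hsucc : (j : ℕ) - 1 + 1 = j := Nat.succ_pred h0
    have hdiv : ((j : ℕ) - 1) / p = (j : ℕ) / p := by
      rw [← Nat.succ_div_of_not_dvd (a := (j : ℕ) - 1) (by rwa [hsucc]), hsucc]
    rw [raising_X]
    simp only [hdiv, hsucc, hj, j.2, not_false_eq_true, and_true]
    by_cases hm : (j : ℕ) / p = m <;> simp [hm]

/-- The lowering and raising derivations satisfy a Heisenberg relation in each block. -/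
lemma lowering_raising_sub (hpn : p ∣ n) (m : ℕ) (F : MvPolynomial (Fin n) (ZMod p)) :
    lowering p n (raising p n m F) - raising p n m (lowering p n F) =
      ∑ j : Fin n with j.val / p = m, X j * pderiv j F := by
  have : ⁅lowering p n, raising p n m⁆ =
      mkDerivation (ZMod p) fun j : Fin n => if (j : ℕ) / p = m then X j else 0 := by
    ext1 j
    rw [Derivation.commutator_apply, lowering_raising_X hpn, raising_lowering_X, mkDerivation_X]
    split_ifs <;> simp [add_smul]
  rw [← Derivation.commutator_apply, this, mkDerivation_eq_sum_pderiv, Finset.sum_filter]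
  simp only [ite_mul, zero_mul]

/-- A monomial in the last variables of the blocks does not occur in the image of the lowering
derivation. -/
lemma coeff_lowering_eq_zero (F : MvPolynomial (Fin n) (ZMod p)) (d : Fin n →₀ ℕ)
    (hd : ∀ j : Fin n, d j ≠ 0 → p ∣ (j : ℕ) + 1) : coeff d (lowering p n F) = 0 := by
  rw [lowering, mkDerivation_eq_sum_pderiv, coeff_sum]
  refine Finset.sum_eq_zero fun j _ => ?_
  rw [smul_mul_assoc, coeff_smul, coeff_X_mul']
  by_cases hj : p ∣ (j : ℕ)
  · simp [(ZMod.natCast_eq_zero_iff _ _).2 hj]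
  · have h0 : (j : ℕ) ≠ 0 := fun h => hj (by simp [h])
    rw [if_neg, smul_zero]
    intro h
    have := hd _ (Finsupp.mem_support_iff.1 h)
    rw [Nat.sub_add_cancel (Nat.pos_of_ne_zero h0)] at this
    exact hj this

lemma sum_pderiv_aeval_esymm (hpn : p ∣ n) (F : MvPolynomial (Fin n) (ZMod p)) :
    ∑ i : Fin n, pderiv i
        (aeval (fun j : Fin n => esymm (Fin n) (ZMod p) ((j : ℕ) + 1)) F) =
      aeval (fun j : Fin n => esymm (Fin n) (ZMod p) ((j : ℕ) + 1)) (lowering p n F) := by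
  have hn : (n : ZMod p) = 0 := (ZMod.natCast_eq_zero_iff _ _).2 hpn
  induction F using MvPolynomial.induction_on with
  | C a => simp [algebraMap_eq]
  | add F G hF hG => simp only [map_add, Finset.sum_add_distrib, hF, hG]
  | mul_X F j hF =>
    have hX : ∑ i : Fin n, pderiv i (esymm (Fin n) (ZMod p) ((j : ℕ) + 1)) =
        aeval (fun j : Fin n => esymm (Fin n) (ZMod p) ((j : ℕ) + 1)) (lowering p n (X j)) := by
      rw [sum_pderiv_esymm_succ n j j.2.le, lowering_X, map_smul, aeval_X, hn, zero_sub]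
      rcases Nat.eq_zero_or_pos (j : ℕ) with h | h
      · simp [h]
      · simp only [Nat.sub_add_cancel h]
    simp only [map_mul, aeval_X, Derivation.leibniz, smul_eq_mul, map_add,
      Finset.sum_add_distrib, ← Finset.mul_sum, hX, hF]

lemma dvd_of_lowering_eq_zero (hpn : p ∣ n) (F : MvPolynomial (Fin n) (ZMod p)) [Fact p.Prime]
    (hF : lowering p n F = 0) (d : Fin n →₀ ℕ) (hd : coeff d F ≠ 0)
    (hsupp : ∀ j : Fin n, d j ≠ 0 → p ∣ (j : ℕ) + 1) (j : Fin n) : p ∣ d j := by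
  by_cases hj : d j = 0
  · simp [hj]
  have h := congrArg (coeff d) (lowering_raising_sub hpn ((j : ℕ) / p) F)
  rw [hF, map_zero, sub_zero, coeff_lowering_eq_zero _ _ hsupp, coeff_sum] at h
  simp only [coeff_X_mul_pderiv] at h
  rw [Finset.sum_eq_single_of_mem j (by simp)] at h
  · rw [← ZMod.natCast_eq_zero_iff]
    exact (mul_eq_zero.1 h.symm).resolve_right hd
  · intro i hi hij
    have hi : (i : ℕ) / p = (j : ℕ) / p := by simpa using hi
    by_cases h0 : d i = 0
    · simp [h0]
    · refine absurd (Fin.ext ?_) hij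
      have hi' := Nat.succ_div_of_dvd (hsupp i h0)
      have hj' := Nat.succ_div_of_dvd (hsupp j hj)
      have := (Nat.div_left_inj (hsupp i h0) (hsupp j hj)).1 (by rw [hi', hj', hi])
      omega

end Blocks

end MvPolynomial

/-- Let `p` be an odd prime and `p ∣ n`.  Suppose `F ∈ 𝔽_p[Y₁,…,Yₙ]` is such that
`f = F(σ₁,…,σₙ) ∈ 𝔽_p[t₁,…,tₙ]` is homogeneous of degree `p²` and `∇(f) = 0`,
where `σₖ` is the `k`-th elementary symmetric polynomial and `∇ = ∑ᵢ ∂/∂tᵢ`.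
If a monomial `Y_p^{i₁} Y_{2p}^{i₂} ⋯ Y_{kp}^{i_k}` (involving only variables
whose index is divisible by `p`, and nonconstant) occurs in `F` with nonzero
coefficient, then that monomial is `Y_p^p`.  (The variable `Yⱼ₊₁` is `X j` for
`j : Fin n`, and a monomial is recorded by its exponent function `d`.) -/
theorem kernel_nabla_monomial (p n : ℕ) (hp : p.Prime) (hodd : Odd p)
    (hn : 1 ≤ n) (hpn : p ∣ n)
    (F : MvPolynomial (Fin n) (ZMod p))
    (hhom : (aeval (fun j : Fin n => esymm (Fin n) (ZMod p) ((j : ℕ) + 1)) F).IsHomogeneous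
      (p ^ 2))
    (hker : (∑ i : Fin n, pderiv i
        (aeval (fun j : Fin n => esymm (Fin n) (ZMod p) ((j : ℕ) + 1)) F)) = 0)
    (d : Fin n →₀ ℕ) (hd : coeff d F ≠ 0)
    (hsupp : ∀ j : Fin n, d j ≠ 0 → p ∣ ((j : ℕ) + 1))
    (hnonconst : ∃ j : Fin n, d j ≠ 0) :
    ∀ j : Fin n, d j = if (j : ℕ) + 1 = p then p else 0 := by
  have : Fact p.Prime := ⟨hp⟩
  have hinj : Function.Injective
      (aeval (fun j : Fin n => esymm (Fin n) (ZMod p) ((j : ℕ) + 1)) :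
        MvPolynomial (Fin n) (ZMod p) →ₐ[ZMod p] MvPolynomial (Fin n) (ZMod p)) := by
    intro F G h
    refine esymmAlgHom_fin_injective (ZMod p) le_rfl (Subtype.ext ?_)
    rwa [esymmAlgHom_apply, esymmAlgHom_apply]
  have hlow : lowering p n F = 0 := by
    apply hinj
    rw [← sum_pderiv_aeval_esymm hpn, hker, map_zero]
  have hdvd := dvd_of_lowering_eq_zero hpn F hlow d hd hsupp
  have hweight : Finsupp.weight (fun j : Fin n => (j : ℕ) + 1) d = p ^ 2 := by
    by_contra hne
    have h := homogeneousComponent_aeval (fun j : Fin n => (j : ℕ) + 1)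
      (fun j : Fin n => esymm (Fin n) (ZMod p) ((j : ℕ) + 1))
      (fun j => esymm_isHomogeneous _ _) (Finsupp.weight (fun j : Fin n => (j : ℕ) + 1) d) F
    rw [homogeneousComponent_of_mem hhom, if_neg hne] at h
    have h := congrArg (coeff d) (hinj (h.symm.trans (map_zero _).symm))
    rw [coeff_weightedHomogeneousComponent, if_pos rfl] at h
    exact hd h
  have hsum : ∑ j : Fin n, d j * ((j : ℕ) + 1) = p ^ 2 := by
    rw [← hweight, Finsupp.weight_apply, Finsupp.sum_fintype _ _ (by simp)]
    simp
  have hmain (j : Fin n) (hj : d j ≠ 0) : d j = p ∧ (j : ℕ) + 1 = p := by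
    have h1 : p ≤ d j := Nat.le_of_dvd (Nat.pos_of_ne_zero hj) (hdvd j)
    have h2 : p ≤ (j : ℕ) + 1 := Nat.le_of_dvd (Nat.succ_pos _) (hsupp j hj)
    have h3 : d j * ((j : ℕ) + 1) ≤ p ^ 2 :=
      hsum ▸ Finset.single_le_sum (f := fun j : Fin n => d j * ((j : ℕ) + 1))
        (fun _ _ => Nat.zero_le _) (Finset.mem_univ j)
    have := hp.pos
    constructor <;> nlinarith
  obtain ⟨i, hi⟩ := hnonconst
  intro j
  split_ifs with h
  · have : j = i := Fin.ext (by have := (hmain i hi).2; omega)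
    exact this ▸ (hmain i hi).1
  · by_contra hj
    exact h (hmain j hj).2
end

section
/- Let Θ̄ : 𝔽_p[t_1,…,t_p] → 𝔽_p[η] be the 𝔽_p-algebra homomorphism determined by t_i ↦ i·η for 1 ≤ i ≤ p. Then Θ̄ sends δ = ∏_{i ≠ j}(t_i − t_j) (product over ordered pairs i ≠ j) to −η^{p²−p}; in particular Θ̄(δ) ≠ 0. -/
open MvPolynomial

/-- Over a finite field the product of all differences of ordered pairs of distinct elements
is `-1`. -/
theorem FiniteField.prod_sub_of_ne (K : Type*) [Field K] [Fintype K] [DecidableEq K] :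
    ∏ q : K × K with q.1 ≠ q.2, (q.1 - q.2) = -1 := by
  have hunits : ∏ c : K with c ≠ 0, c = -1 := by
    have h := congrArg Units.val (FiniteField.prod_univ_units_id_eq_neg_one (K := K))
    rw [Units.coe_prod, Units.val_neg, Units.val_one] at h
    rw [← h]
    symm
    refine Finset.prod_bij (fun u _ => (u : K)) (by simp) (fun _ _ _ _ => Units.ext) ?_ (by simp)
    intro b hb
    exact ⟨Units.mk0 b (by simpa using hb), Finset.mem_univ _, rfl⟩
  have hrow (a : K) : ∏ b : K, (if a ≠ b then a - b else 1) = -1 := by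
    rw [← hunits, Finset.prod_filter]
    refine Fintype.prod_equiv (Equiv.subLeft a) _ _ fun b => ?_
    simp [sub_eq_zero]
  rw [Finset.prod_filter, Fintype.prod_prod_type]
  simp only [hrow, Finset.prod_const, Finset.card_univ]
  exact FiniteField.pow_card (-1 : K)

/-- The residues `i + 1` for `i < p` run through `ZMod p` exactly once. -/
theorem ZMod.bijective_fin_val_add_one (p : ℕ) [NeZero p] :
    Function.Bijective (fun i : Fin p => ((i : ℕ) + 1 : ZMod p)) := by
  rw [Fintype.bijective_iff_injective_and_card]
  refine ⟨fun i j h => ?_, by simp [ZMod.card]⟩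
  have h' : ((i : ℕ) : ZMod p) = ((j : ℕ) : ZMod p) := add_right_cancel h
  rw [ZMod.natCast_eq_natCast_iff'] at h'
  rwa [Nat.mod_eq_of_lt i.isLt, Nat.mod_eq_of_lt j.isLt, Fin.val_inj] at h'

/-- The product of the differences `(i + 1) - (j + 1)` over ordered pairs `i ≠ j` of indices
below a prime `p` is `-1` in `ZMod p`. -/
theorem ZMod.prod_fin_sub_of_ne (p : ℕ) [Fact p.Prime] :
    ∏ q : Fin p × Fin p with q.1 ≠ q.2,
      (((q.1 : ℕ) + 1 : ZMod p) - ((q.2 : ℕ) + 1 : ZMod p)) = -1 := by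
  let e := Equiv.ofBijective _ (ZMod.bijective_fin_val_add_one p)
  rw [← FiniteField.prod_sub_of_ne (ZMod p), Finset.prod_filter, Finset.prod_filter]
  refine Fintype.prod_equiv (e.prodCongr e) _ _ fun q => ?_
  simp only [Equiv.prodCongr_apply, Prod.map_fst, Prod.map_snd, ne_eq, e.injective.eq_iff]
  rfl

/-- Let `p` be an odd prime and `Θ̄ : 𝔽_p[t₁,…,t_p] → 𝔽_p[η]` the algebra map
with `tᵢ ↦ i·η` (here `tᵢ₊₁` is the variable `X i` for `i : Fin p`, and `η` is
`Polynomial.X`).  Then `Θ̄` sends `δ = ∏_{i ≠ j}(tᵢ − tⱼ)` (product over ordered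
pairs) to `−η^{p²−p}`; in particular `Θ̄(δ) ≠ 0`. -/
theorem theta_delta (p : ℕ) (hp : p.Prime) (hodd : Odd p) :
    aeval (fun i : Fin p => (((i : ℕ) + 1 : ZMod p)) • (Polynomial.X : Polynomial (ZMod p)))
        (∏ q ∈ Finset.univ.filter (fun q : Fin p × Fin p => q.1 ≠ q.2),
          (X q.1 - X q.2 : MvPolynomial (Fin p) (ZMod p)))
      = -(Polynomial.X : Polynomial (ZMod p)) ^ (p ^ 2 - p) ∧
    aeval (fun i : Fin p => (((i : ℕ) + 1 : ZMod p)) • (Polynomial.X : Polynomial (ZMod p)))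
        (∏ q ∈ Finset.univ.filter (fun q : Fin p × Fin p => q.1 ≠ q.2),
          (X q.1 - X q.2 : MvPolynomial (Fin p) (ZMod p)))
      ≠ 0 := by
  have : Fact p.Prime := ⟨hp⟩
  have hcard : (Finset.univ.filter (fun q : Fin p × Fin p => q.1 ≠ q.2)).card = p ^ 2 - p := by
    have h : Finset.univ.filter (fun q : Fin p × Fin p => q.1 ≠ q.2) = Finset.univ.offDiag := by
      ext q
      simp
    rw [h, Finset.offDiag_card, Finset.card_univ, Fintype.card_fin, sq]
  rw [and_iff_left_of_imp fun h => h ▸ neg_ne_zero.mpr (pow_ne_zero _ Polynomial.X_ne_zero)]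
  simp only [map_prod, map_sub, aeval_X, ← sub_smul]
  rw [Finset.prod_smul, ZMod.prod_fin_sub_of_ne, Finset.prod_const, hcard, neg_one_smul]
end

section
/- A polynomial g ∈ 𝔽_p[ξ,η] satisfies M·g = g for every M ∈ SL_2(𝔽_p) if and only if g lies in the 𝔽_p-subalgebra generated by the two homogeneous polynomials f = ξ^pη − η^pξ and h = ξ^{p²−p} + η^{p−1}(ξ^{p−1} − η^{p−1})^{p−1}. -/
open MvPolynomial

namespace DicksonSL2

/-- The substitution `X i ↦ ∑ j, M j i X j`. -/
noncomputable def subst {R : Type*} [CommRing R] (M : Matrix (Fin 2) (Fin 2) R) :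
    MvPolynomial (Fin 2) R →ₐ[R] MvPolynomial (Fin 2) R :=
  aeval fun i : Fin 2 => ∑ j : Fin 2, C (M j i) * X j

section CommRing

variable {R : Type*} [CommRing R]

lemma subst_X (M : Matrix (Fin 2) (Fin 2) R) (i : Fin 2) :
    subst M (X i) = C (M 0 i) * X 0 + C (M 1 i) * X 1 := by
  simp [subst, Fin.sum_univ_two]

/-- Restriction of a bivariate polynomial to the line `X 0 = 0`. -/
noncomputable def restrict : MvPolynomial (Fin 2) R →ₐ[R] Polynomial R :=
  aeval ![0, Polynomial.X]

@[simp] lemma restrict_X_zero : restrict (X 0 : MvPolynomial (Fin 2) R) = 0 := by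
  simp [restrict]

@[simp] lemma restrict_X_one : restrict (X 1 : MvPolynomial (Fin 2) R) = Polynomial.X := by
  simp [restrict]

@[simp] lemma restrict_C (a : R) :
    restrict (C a : MvPolynomial (Fin 2) R) = Polynomial.C a :=
  restrict.commutes a

lemma X_zero_dvd_sub_aeval_restrict (g : MvPolynomial (Fin 2) R) :
    X 0 ∣ g - Polynomial.aeval (X 1 : MvPolynomial (Fin 2) R) (restrict g) := by
  rw [← Ideal.mem_span_singleton, ← Ideal.Quotient.mk_eq_mk_iff_sub_mem,
    ← Ideal.Quotient.mkₐ_eq_mk R]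
  have hcomp : Ideal.Quotient.mkₐ R (Ideal.span {(X 0 : MvPolynomial (Fin 2) R)}) =
      ((Ideal.Quotient.mkₐ R (Ideal.span {X 0})).comp
        (Polynomial.aeval (X 1))).comp restrict := by
    ext i
    fin_cases i
    · simp
    · simp
  exact DFunLike.congr_fun hcomp g

lemma X_zero_dvd_of_restrict_eq_zero {g : MvPolynomial (Fin 2) R} (hg : restrict g = 0) :
    X 0 ∣ g := by
  simpa [hg] using X_zero_dvd_sub_aeval_restrict g

lemma restrict_subst_transvection (g : MvPolynomial (Fin 2) R) :
    restrict (subst !![1, 1; 0, 1] g) = restrict g := by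
  have hcomp : restrict.comp (subst !![1, 1; 0, 1]) = restrict (R := R) := by
    ext i : 1
    fin_cases i <;> simp [subst_X]
  exact DFunLike.congr_fun hcomp g

lemma restrict_pderiv_subst_transvection (g : MvPolynomial (Fin 2) R) :
    restrict (pderiv 0 (subst !![1, 1; 0, 1] g)) =
      restrict (pderiv 0 g) + Polynomial.derivative (restrict g) := by
  induction g using MvPolynomial.induction_on with
  | C a => simp [subst]
  | add a b ha hb => simp only [map_add, ha, hb]; ring
  | mul_X a i ha =>
    simp only [map_mul, Derivation.leibniz, map_add, smul_eq_mul, ha,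
      restrict_subst_transvection, Polynomial.derivative_mul]
    fin_cases i
    · simp [subst_X, pderiv_X]
    · simp [subst_X, pderiv_X]
      ring

lemma derivative_restrict_eq_zero {g : MvPolynomial (Fin 2) R}
    (hg : subst !![1, 1; 0, 1] g = g) : Polynomial.derivative (restrict g) = 0 := by
  simpa [hg] using restrict_pderiv_subst_transvection g

lemma restrict_subst_diagonal (s t : R) (g : MvPolynomial (Fin 2) R) :
    restrict (subst !![s, 0; 0, t] g) = (restrict g).comp (Polynomial.C t * Polynomial.X) := by
  rw [Polynomial.comp_eq_aeval]
  have hcomp : restrict.comp (subst !![s, 0; 0, t]) =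
      (Polynomial.aeval (Polynomial.C t * Polynomial.X)).comp restrict := by
    ext i : 1
    fin_cases i <;> simp [subst_X]
  exact DFunLike.congr_fun hcomp g

lemma natDegree_restrict_le (g : MvPolynomial (Fin 2) R) :
    (restrict g).natDegree ≤ g.totalDegree := by
  simpa [restrict] using aeval_natDegree_le (n := 1) g le_rfl ![0, Polynomial.X]
    (by intro i; fin_cases i <;> simp [Polynomial.natDegree_X_le])

lemma totalDegree_aeval_le {σ : Type*} (h : MvPolynomial σ R) (P : Polynomial R) :
    (Polynomial.aeval h P).totalDegree ≤ P.natDegree * h.totalDegree := by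
  rw [Polynomial.aeval_eq_sum_range]
  refine totalDegree_finsetSum_le fun i hi => ?_
  refine (totalDegree_smul_le _ _).trans ((totalDegree_pow _ _).trans ?_)
  exact Nat.mul_le_mul_right _ (Nat.lt_succ_iff.mp (Finset.mem_range.mp hi))

end CommRing

variable (p : ℕ)

/-- The invariant of degree `p + 1`. -/
noncomputable def f : MvPolynomial (Fin 2) (ZMod p) := X 0 ^ p * X 1 - X 1 ^ p * X 0

/-- The invariant of degree `p ^ 2 - p`. -/
noncomputable def h : MvPolynomial (Fin 2) (ZMod p) :=
  X 0 ^ (p ^ 2 - p) + X 1 ^ (p - 1) * (X 0 ^ (p - 1) - X 1 ^ (p - 1)) ^ (p - 1)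

lemma sq_sub_self : p ^ 2 - p = (p - 1) * p := by
  rw [Nat.sub_mul, sq, one_mul]

variable [Fact p.Prime]

lemma sq_sub_self_eq_add : p ^ 2 - p = (p - 1) + (p - 1) * (p - 1) := by
  rw [sq_sub_self]
  nth_rewrite 2 [← Nat.sub_add_cancel (Fact.out : p.Prime).one_le]
  ring

lemma f_eq_prod : f p = -X 0 * ∏ c : ZMod p, (X 1 - C c * X 0) := by
  have hpoly : ∏ c : ZMod p, (Polynomial.X - Polynomial.C c) =
      (Polynomial.X ^ p - Polynomial.X : Polynomial (ZMod p)) := by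
    have hcard : (Fintype.card (ZMod p)) = p := ZMod.card p
    have hr := FiniteField.roots_X_pow_card_sub_X (ZMod p)
    have hd := FiniteField.X_pow_card_sub_X_natDegree_eq (ZMod p)
      (Fact.out : p.Prime).one_lt
    rw [hcard] at hr
    have hm : (Polynomial.X ^ p - Polynomial.X : Polynomial (ZMod p)).Monic :=
      Polynomial.monic_X_pow_sub (by simpa using (Fact.out : p.Prime).one_lt)
    have := Polynomial.prod_multiset_X_sub_C_of_monic_of_roots_card_eq hm
      (by rw [hr, hd, Finset.card_val, Finset.card_univ, hcard])
    rwa [hr] at this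
  apply IsFractionRing.injective (MvPolynomial (Fin 2) (ZMod p))
    (FractionRing (MvPolynomial (Fin 2) (ZMod p)))
  set A := algebraMap (MvPolynomial (Fin 2) (ZMod p))
    (FractionRing (MvPolynomial (Fin 2) (ZMod p)))
  have hx : A (X 0) ≠ 0 := by
    simp [A]
  have key := congrArg (Polynomial.eval₂ (A.comp C) (A (X 1) / A (X 0))) hpoly
  rw [Polynomial.eval₂_finsetProd] at key
  simp only [Polynomial.eval₂_sub, Polynomial.eval₂_X, Polynomial.eval₂_C,
    Polynomial.eval₂_pow, RingHom.comp_apply] at key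
  have hprod : ∏ c : ZMod p, A (X 1 - C c * X 0) =
      A (X 0) ^ p * ∏ c : ZMod p, (A (X 1) / A (X 0) - A (C c)) := by
    have : A (X 0) ^ p = ∏ _c : ZMod p, A (X 0) := by simp [ZMod.card]
    rw [this, ← Finset.prod_mul_distrib]
    refine Finset.prod_congr rfl fun c _ => ?_
    simp only [map_sub, map_mul]
    field_simp
  rw [map_mul, map_prod, hprod, key, f]
  simp only [map_sub, map_mul, map_pow, map_neg, div_pow]
  field_simp
  ring

lemma f_ne_zero : f p ≠ 0 := by
  rw [f_eq_prod]
  refine mul_ne_zero (neg_ne_zero.mpr (X_ne_zero _)) (Finset.prod_ne_zero_iff.mpr fun c _ hc => ?_)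
  have := congrArg restrict hc
  simp at this

lemma f_mul_h : f p * h p = X 0 ^ (p ^ 2) * X 1 - X 1 ^ (p ^ 2) * X 0 := by
  have hp := (Fact.out : p.Prime)
  have h1 : ∀ x : MvPolynomial (Fin 2) (ZMod p), x ^ p = x * x ^ (p - 1) := fun x => by
    rw [← pow_succ', Nat.sub_add_cancel hp.one_le]
  have h2 : ∀ x : MvPolynomial (Fin 2) (ZMod p), x ^ (p ^ 2) = x ^ p * x ^ (p ^ 2 - p) := by
    intro x
    rw [← pow_add, Nat.add_sub_cancel' (Nat.le_self_pow two_ne_zero p)]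
  have h3 : (X 0 ^ (p - 1) - X 1 ^ (p - 1) : MvPolynomial (Fin 2) (ZMod p)) *
      (X 0 ^ (p - 1) - X 1 ^ (p - 1)) ^ (p - 1) = X 0 ^ (p ^ 2 - p) - X 1 ^ (p ^ 2 - p) := by
    rw [← h1, sub_pow_char, ← pow_mul, ← pow_mul, ← sq_sub_self]
  rw [f, h, h2, h2, h1, h1]
  linear_combination (X 0 * X 1 * X 1 ^ (p - 1) : MvPolynomial (Fin 2) (ZMod p)) * h3

lemma restrict_h (hodd : Odd p) : restrict (h p) = Polynomial.X ^ (p ^ 2 - p) := by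
  have hp := (Fact.out : p.Prime)
  have h2 : p - 1 ≠ 0 := Nat.sub_ne_zero_of_lt hp.one_lt
  have he : Even (p - 1) := hodd.tsub_odd odd_one
  have h3 : p ^ 2 - p ≠ 0 := by
    rw [sq_sub_self]; exact mul_ne_zero h2 hp.ne_zero
  simp only [h, map_add, map_mul, map_sub, map_pow, restrict_X_zero, restrict_X_one,
    zero_pow h2, zero_pow h3, zero_sub, zero_add, he.neg_pow]
  rw [← pow_mul, ← pow_add, ← sq_sub_self_eq_add]

lemma totalDegree_h_le : (h p).totalDegree ≤ p ^ 2 - p := by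
  refine (totalDegree_add _ _).trans (max_le (totalDegree_X_pow _ _).le ?_)
  rw [sq_sub_self_eq_add]
  refine (totalDegree_mul _ _).trans (add_le_add (totalDegree_X_pow _ _).le
    ((totalDegree_pow _ _).trans (Nat.mul_le_mul_left _ ?_)))
  refine (totalDegree_sub _ _).trans (max_le ?_ ?_) <;> exact (totalDegree_X_pow _ _).le

lemma subst_X_pow_sub {k : ℕ} (M : Matrix (Fin 2) (Fin 2) (ZMod p)) (hM : M.det = 1) :
    subst M (X 0 ^ p ^ k * X 1 - X 1 ^ p ^ k * X 0) =
      X 0 ^ p ^ k * X 1 - X 1 ^ p ^ k * X 0 := by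
  have hdet : (C (M 0 0) * C (M 1 1) - C (M 0 1) * C (M 1 0) :
      MvPolynomial (Fin 2) (ZMod p)) = 1 := by
    rw [← C_mul, ← C_mul, ← C_sub, ← Matrix.det_fin_two, hM, C_1]
  have hC : ∀ a : ZMod p, (C a : MvPolynomial (Fin 2) (ZMod p)) ^ p ^ k = C a := fun a => by
    rw [← C_pow, ZMod.pow_card_pow]
  simp only [map_sub, map_mul, map_pow, subst_X, add_pow_char_pow, mul_pow, hC]
  linear_combination (X 0 ^ p ^ k * X 1 - X 1 ^ p ^ k * X 0) * hdet

lemma subst_f (M : Matrix (Fin 2) (Fin 2) (ZMod p)) (hM : M.det = 1) : subst M (f p) = f p := by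
  simpa [f] using subst_X_pow_sub p (k := 1) M hM

lemma subst_h (M : Matrix (Fin 2) (Fin 2) (ZMod p)) (hM : M.det = 1) :
    subst M (h p) = h p := by
  apply mul_left_cancel₀ (f_ne_zero p)
  conv_lhs => rw [← subst_f p M hM]
  rw [← map_mul, f_mul_h, subst_X_pow_sub p M hM]

/-- Invariance under all substitutions of determinant one. -/
def IsInvariant (g : MvPolynomial (Fin 2) (ZMod p)) : Prop :=
  ∀ M : Matrix (Fin 2) (Fin 2) (ZMod p), M.det = 1 → subst M g = g

variable {p} {g : MvPolynomial (Fin 2) (ZMod p)}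

lemma IsInvariant.exists_restrict_eq (hg : IsInvariant p g) :
    ∃ P : Polynomial (ZMod p), restrict g = Polynomial.expand (ZMod p) (p ^ 2 - p) P := by
  have hp := (Fact.out : p.Prime)
  have hd := derivative_restrict_eq_zero (hg !![1, 1; 0, 1] (by simp [Matrix.det_fin_two]))
  have hpos : 0 < p ^ 2 - p := by
    rw [sq_sub_self]; exact Nat.mul_pos (Nat.sub_pos_of_lt hp.one_lt) hp.pos
  refine ⟨Polynomial.contract (p ^ 2 - p) (restrict g), ?_⟩
  ext n
  rw [Polynomial.coeff_expand hpos, Polynomial.coeff_contract hpos.ne']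
  split_ifs with hn
  · rw [Nat.div_mul_cancel hn]
  by_contra hne
  apply hn
  rw [sq_sub_self]
  refine Nat.Coprime.mul_dvd_of_dvd_of_dvd ?_ ?_ ?_
  · exact (hp.coprime_iff_not_dvd.mpr (Nat.not_dvd_of_pos_of_lt
      (Nat.sub_pos_of_lt hp.one_lt) (Nat.sub_lt hp.pos one_pos))).symm
  · rw [← ZMod.card p, ← FiniteField.forall_pow_eq_one_iff (ZMod p)]
    intro t
    have ht := restrict_subst_diagonal (↑t⁻¹ : ZMod p) t g
    rw [hg _ (by rw [Matrix.det_fin_two_of, Units.inv_mul, mul_zero, sub_zero])] at ht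
    have := congrArg (Polynomial.coeff · n) ht
    simp only [Polynomial.comp_C_mul_X_coeff] at this
    have htn := mul_left_cancel₀ hne (this.symm.trans (mul_one _).symm)
    exact Units.ext (by rw [Units.val_pow_eq_pow_val, htn, Units.val_one])
  · by_contra hpn
    rw [← Polynomial.expand_contract p hd hp.ne_zero, Polynomial.coeff_expand hp.pos,
      if_neg hpn] at hne
    exact hne rfl

lemma IsInvariant.f_dvd (hg : IsInvariant p g) (hr : restrict g = 0) : f p ∣ g := by
  obtain ⟨q, rfl⟩ := X_zero_dvd_of_restrict_eq_zero hr
  have hlin : ∀ c : ZMod p, (X 1 - C c * X 0) ∣ X 0 * q := by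
    intro c
    rw [← hg !![-c, -1; 1, 0] (by simp [Matrix.det_fin_two]), map_mul]
    refine Dvd.dvd.mul_right (dvd_of_eq ?_) _
    simp [subst_X]
    ring
  have hX : IsRelPrime (X 0 : MvPolynomial (Fin 2) (ZMod p)) (X 1) := by
    rw [X_prime.irreducible.isRelPrime_iff_not_dvd, X_dvd_X]
    simp
  have h0 : ∀ c : ZMod p, IsRelPrime (X 0 : MvPolynomial (Fin 2) (ZMod p)) (X 1 - C c * X 0) := by
    intro c d hd0 hd
    exact hX hd0 ((dvd_sub_left (hd0.mul_left _)).mp hd)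
  rw [f_eq_prod, neg_mul, neg_dvd]
  refine IsRelPrime.mul_dvd (IsRelPrime.prod_right fun c _ => h0 c) (dvd_mul_right _ _) ?_
  refine Finset.prod_dvd_of_isRelPrime ?_ fun c _ => hlin c
  intro c _ c' _ hne d hd hd'
  refine h0 c ?_ hd
  have hunit : IsUnit (C (c' - c) : MvPolynomial (Fin 2) (ZMod p)) :=
    (sub_ne_zero.mpr hne.symm).isUnit.map C
  rw [← hunit.dvd_mul_left]
  convert dvd_sub hd hd' using 1
  rw [C_sub]
  ring

lemma isInvariant_of_mem_adjoin (hg : g ∈ Algebra.adjoin (ZMod p) {f p, h p}) : IsInvariant p g := by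
  intro M hM
  have : Algebra.adjoin (ZMod p) {f p, h p} ≤ AlgHom.equalizer (subst M) (AlgHom.id _ _) := by
    rw [Algebra.adjoin_le_iff]
    rintro x (rfl | rfl)
    · exact subst_f p M hM
    · exact subst_h p M hM
  exact this hg

theorem IsInvariant.mem_adjoin (hodd : Odd p) (hg : IsInvariant p g) :
    g ∈ Algebra.adjoin (ZMod p) {f p, h p} := by
  induction hn : g.totalDegree using Nat.strong_induction_on generalizing g with
  | _ n ih =>
  obtain ⟨P, hP⟩ := hg.exists_restrict_eq
  have hPmem : Polynomial.aeval (h p) P ∈ Algebra.adjoin (ZMod p) {f p, h p} :=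
    Algebra.adjoin_mono (by simp) (Polynomial.aeval_mem_adjoin_singleton _ _)
  have hinv : IsInvariant p (g - Polynomial.aeval (h p) P) := fun M hM => by
    rw [map_sub, hg M hM, isInvariant_of_mem_adjoin hPmem M hM]
  have hres : restrict (g - Polynomial.aeval (h p) P) = 0 := by
    rw [map_sub, hP, ← Polynomial.aeval_algHom_apply, restrict_h p hodd,
      ← Polynomial.comp_eq_aeval,
      ← Polynomial.expand_eq_comp_X_pow, sub_self]
  obtain ⟨q, hq⟩ := hinv.f_dvd hres
  rw [← sub_add_cancel g (Polynomial.aeval (h p) P), hq]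
  refine add_mem (mul_mem (Algebra.subset_adjoin (by simp)) ?_) hPmem
  rcases eq_or_ne q 0 with rfl | hq0
  · exact zero_mem _
  have hqinv : IsInvariant p q := fun M hM => by
    apply mul_left_cancel₀ (f_ne_zero p)
    conv_lhs => rw [← subst_f p M hM]
    rw [← map_mul, ← hq, hinv M hM]
  refine ih q.totalDegree ?_ hqinv rfl
  have hdeg : (g - Polynomial.aeval (h p) P).totalDegree ≤ n := by
    refine (totalDegree_sub _ _).trans (max_le hn.le ?_)
    calc _ ≤ P.natDegree * (h p).totalDegree := totalDegree_aeval_le _ _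
      _ ≤ P.natDegree * (p ^ 2 - p) := Nat.mul_le_mul_left _ (totalDegree_h_le p)
      _ = (restrict g).natDegree := by rw [hP, Polynomial.natDegree_expand]
      _ ≤ n := hn ▸ natDegree_restrict_le g
  rw [hq, totalDegree_mul_of_isDomain (f_ne_zero p) hq0] at hdeg
  have hf : 1 ≤ (f p).totalDegree := by
    rw [← totalDegree_X (R := ZMod p) (0 : Fin 2)]
    exact totalDegree_le_of_dvd_of_isDomain
      (f_eq_prod p ▸ ((dvd_neg.mpr dvd_rfl).mul_right _)) (f_ne_zero p)
  omega

end DicksonSL2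

/-- Dickson's theorem for `SL₂(𝔽_p)`: a polynomial `g ∈ 𝔽_p[ξ,η]` (with `ξ = X 0`,
`η = X 1`) is invariant under the `SL₂(𝔽_p)`-action
`ξ ↦ M₁₁ξ + M₂₁η, η ↦ M₁₂ξ + M₂₂η` iff `g` lies in the subalgebra generated by
`f = ξ^pη − η^pξ` and `h = ξ^{p²−p} + η^{p−1}(ξ^{p−1} − η^{p−1})^{p−1}`. -/
theorem dickson_SL2_invariants (p : ℕ) (hp : p.Prime) (hodd : Odd p)
    (g : MvPolynomial (Fin 2) (ZMod p)) :
    (∀ M : Matrix.SpecialLinearGroup (Fin 2) (ZMod p),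
        aeval (fun i : Fin 2 =>
          ∑ j : Fin 2, C ((M : Matrix (Fin 2) (Fin 2) (ZMod p)) j i) * X j) g = g) ↔
      g ∈ Algebra.adjoin (ZMod p)
        ({X 0 ^ p * X 1 - X 1 ^ p * X 0,
          X 0 ^ (p ^ 2 - p) + X 1 ^ (p - 1) * (X 0 ^ (p - 1) - X 1 ^ (p - 1)) ^ (p - 1)} :
          Set (MvPolynomial (Fin 2) (ZMod p))) := by
  have : Fact p.Prime := ⟨hp⟩
  exact ⟨fun H => DicksonSL2.IsInvariant.mem_adjoin hodd fun M hM => H ⟨M, hM⟩,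
    fun H M => DicksonSL2.isInvariant_of_mem_adjoin H M M.det_coe⟩
end

section
/- An element g ∈ A satisfies M·g = g for every M ∈ SL_2(𝔽_p) if and only if g lies in the 𝔽_p-subalgebra of A generated by the five elements f, h, s, y, z. -/
open MvPolynomial TensorProduct

namespace MuiInvariants

section Polynomial

variable {p : ℕ}

/-- The linear substitution on `𝔽_p[ξ, η]` attached to `M ∈ SL₂(𝔽_p)`. -/
noncomputable def subst (M : Matrix.SpecialLinearGroup (Fin 2) (ZMod p)) :
    MvPolynomial (Fin 2) (ZMod p) →ₐ[ZMod p] MvPolynomial (Fin 2) (ZMod p) :=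
  aeval (fun i : Fin 2 =>
    ∑ j : Fin 2, C ((M : Matrix (Fin 2) (Fin 2) (ZMod p)) j i) * X j)

/-- Restriction of a polynomial in `ξ, η` to the line `η = 0`. -/
noncomputable def restrict (p : ℕ) : MvPolynomial (Fin 2) (ZMod p) →ₐ[ZMod p] Polynomial (ZMod p) :=
  aeval ![Polynomial.X, 0]

/-- The invariant `ξ^p η - η^p ξ`. -/
noncomputable def dicksonF (p : ℕ) : MvPolynomial (Fin 2) (ZMod p) :=
  X 0 ^ p * X 1 - X 1 ^ p * X 0

/-- The invariant `ξ^(p²-p) + η^(p-1) (ξ^(p-1) - η^(p-1))^(p-1)`. -/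
noncomputable def dicksonH (p : ℕ) : MvPolynomial (Fin 2) (ZMod p) :=
  X 0 ^ (p ^ 2 - p) + X 1 ^ (p - 1) * (X 0 ^ (p - 1) - X 1 ^ (p - 1)) ^ (p - 1)

@[simp]
lemma subst_X (M : Matrix.SpecialLinearGroup (Fin 2) (ZMod p)) (i : Fin 2) :
    subst M (X i) = C (M.1 0 i) * X 0 + C (M.1 1 i) * X 1 := by
  simp [subst, Fin.sum_univ_two]

@[simp]
lemma subst_C (M : Matrix.SpecialLinearGroup (Fin 2) (ZMod p)) (c : ZMod p) :
    subst M (C c) = C c := by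
  simp [subst]

@[simp]
lemma restrict_X_zero : restrict p (X 0) = Polynomial.X := by simp [restrict]

@[simp]
lemma restrict_X_one : restrict p (X 1) = 0 := by simp [restrict]

@[simp]
lemma restrict_C (c : ZMod p) : restrict p (C c) = Polynomial.C c := by simp [restrict]

lemma X_one_dvd_sub_aeval_restrict (g : MvPolynomial (Fin 2) (ZMod p)) :
    (X 1 : MvPolynomial (Fin 2) (ZMod p)) ∣ g - Polynomial.aeval (X 0) (restrict p g) := by
  induction g using MvPolynomial.induction_on with
  | C c => simp [MvPolynomial.algebraMap_eq]
  | add g₁ g₂ h₁ h₂ =>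
    rw [map_add, map_add, add_sub_add_comm]
    exact dvd_add h₁ h₂
  | mul_X g i h =>
    fin_cases i
    · simpa [sub_mul] using h.mul_right (X 0)
    · simp

lemma X_one_dvd_of_restrict_eq_zero {g : MvPolynomial (Fin 2) (ZMod p)} (hg : restrict p g = 0) :
    (X 1 : MvPolynomial (Fin 2) (ZMod p)) ∣ g := by
  simpa [hg] using X_one_dvd_sub_aeval_restrict g

lemma det_expand (M : Matrix.SpecialLinearGroup (Fin 2) (ZMod p)) :
    M.1 0 0 * M.1 1 1 - M.1 0 1 * M.1 1 0 = 1 := by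
  rw [← Matrix.det_fin_two]; exact M.2

lemma C_det_expand (M : Matrix.SpecialLinearGroup (Fin 2) (ZMod p)) :
    (C (M.1 0 0) * C (M.1 1 1) - C (M.1 0 1) * C (M.1 1 0) : MvPolynomial (Fin 2) (ZMod p)) = 1 := by
  rw [← C_mul, ← C_mul, ← C_sub, det_expand, C_1]

variable [Fact p.Prime]

lemma dicksonF_ne_zero : dicksonF p ≠ 0 := by
  intro h
  have h2 := congrArg (aeval ![(Polynomial.X : Polynomial (ZMod p)), 1]) h
  exact FiniteField.X_pow_card_sub_X_ne_zero (ZMod p) (Fact.out : p.Prime).one_lt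
    (by simpa [dicksonF] using h2)

lemma subst_X_pow_prime (M : Matrix.SpecialLinearGroup (Fin 2) (ZMod p)) (i : Fin 2) (n : ℕ) :
    subst M (X i ^ p ^ n) = C (M.1 0 i) * X 0 ^ p ^ n + C (M.1 1 i) * X 1 ^ p ^ n := by
  rw [map_pow, subst_X, add_pow_char_pow, mul_pow, mul_pow, ← C_pow, ← C_pow,
    ZMod.pow_card_pow, ZMod.pow_card_pow]

/-- The determinant `ξ^(p^n) η - η^(p^n) ξ` is invariant. -/
lemma subst_pow_prime_det (M : Matrix.SpecialLinearGroup (Fin 2) (ZMod p)) (n : ℕ) :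
    subst M (X 0 ^ p ^ n * X 1 - X 1 ^ p ^ n * X 0) = X 0 ^ p ^ n * X 1 - X 1 ^ p ^ n * X 0 := by
  rw [map_sub, map_mul, map_mul, subst_X_pow_prime, subst_X_pow_prime, subst_X, subst_X]
  linear_combination (X 0 ^ p ^ n * X 1 - X 1 ^ p ^ n * X 0) * C_det_expand M

lemma subst_dicksonF (M : Matrix.SpecialLinearGroup (Fin 2) (ZMod p)) :
    subst M (dicksonF p) = dicksonF p := by
  simpa [dicksonF] using subst_pow_prime_det M 1

lemma dicksonH_mul_dicksonF :
    dicksonH p * dicksonF p = X 0 ^ p ^ 2 * X 1 - X 1 ^ p ^ 2 * X 0 := by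
  have hp := (Fact.out : p.Prime).two_le
  obtain ⟨k, rfl⟩ : ∃ k, p = k + 1 := ⟨p - 1, by omega⟩
  have h := sub_pow_char (p := k + 1) (X 0 ^ k : MvPolynomial (Fin 2) (ZMod (k + 1))) (X 1 ^ k)
  have e : (k + 1) ^ 2 - (k + 1) = k * (k + 1) := by
    rw [Nat.sub_eq_iff_eq_add (by nlinarith)]; ring
  rw [dicksonH, dicksonF, e, Nat.add_sub_cancel]
  rw [pow_succ] at h
  linear_combination (X 1 ^ k * X 0 * X 1) * h

lemma subst_dicksonH (M : Matrix.SpecialLinearGroup (Fin 2) (ZMod p)) :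
    subst M (dicksonH p) = dicksonH p := by
  apply mul_right_cancel₀ (dicksonF_ne_zero (p := p))
  conv_lhs => rw [← subst_dicksonF M]
  rw [← map_mul, dicksonH_mul_dicksonF, subst_pow_prime_det]

/-- An invariant that vanishes on the line `η = 0` vanishes on all lines, so that `f` divides it. -/
lemma dicksonF_dvd_of_restrict_eq_zero {g : MvPolynomial (Fin 2) (ZMod p)}
    (hg : ∀ M, subst M g = g) (h0 : restrict p g = 0) : dicksonF p ∣ g := by
  have hp := (Fact.out : p.Prime).two_le
  obtain ⟨q, rfl⟩ := X_one_dvd_of_restrict_eq_zero h0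
  let e := finSuccEquiv (ZMod p) 1
  have he0 : e (X 0) = Polynomial.X := finSuccEquiv_X_zero
  have he1 : e (X 1) = Polynomial.C (X 0) := finSuccEquiv_X_succ (j := (0 : Fin 1))
  have heC (c : ZMod p) : e (C c) = Polynomial.C (C c) := by
    simp [e, finSuccEquiv_apply]
  have hroot (c : ZMod p) : (e q).eval (C c * X 0) = 0 := by
    obtain ⟨M, hM⟩ : ∃ M : Matrix.SpecialLinearGroup (Fin 2) (ZMod p), M.1 = !![0, 1; -1, -c] :=
      ⟨⟨!![0, 1; -1, -c], by simp [Matrix.det_fin_two]⟩, rfl⟩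
    have h := hg M
    rw [map_mul, subst_X] at h
    have := congrArg (fun r => (e r).eval (C c * X 0)) h
    simpa [hM, he0, he1, heC] using this.symm
  let N : Polynomial (MvPolynomial (Fin 1) (ZMod p)) :=
    Polynomial.X ^ p - Polynomial.C (X 0 ^ (p - 1)) * Polynomial.X
  have hdeg : (Polynomial.C (X 0 ^ (p - 1) : MvPolynomial (Fin 1) (ZMod p)) *
      Polynomial.X).degree < (p : WithBot ℕ) :=
    (Polynomial.degree_C_mul_X_le _).trans_lt (Nat.one_lt_cast.2 (show 1 < p by omega))
  have hN : N.Monic := Polynomial.monic_X_pow_sub hdeg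
  have hNdeg : N.degree = p := by
    rw [Polynomial.degree_sub_eq_left_of_degree_lt] <;> rw [Polynomial.degree_X_pow]
    exact hdeg
  have hNroot (c : ZMod p) : N.eval (C c * X 0) = 0 := by
    have h1 : (X 0 : MvPolynomial (Fin 1) (ZMod p)) ^ (p - 1) * X 0 = X 0 ^ p := by
      rw [← pow_succ, Nat.sub_add_cancel (by omega)]
    simp only [N, Polynomial.eval_sub, Polynomial.eval_pow, Polynomial.eval_mul,
      Polynomial.eval_X, Polynomial.eval_C, mul_pow, ← C_pow, ZMod.pow_card]
    linear_combination -C c * h1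
  have hinj : Function.Injective (fun c : ZMod p => (C c * X 0 : MvPolynomial (Fin 1) (ZMod p))) :=
    fun c d h => C_injective _ _ (mul_right_cancel₀ (X_ne_zero _) h)
  have hr : (e q) %ₘ N = 0 := by
    refine Polynomial.eq_zero_of_natDegree_lt_card_of_eval_eq_zero _ hinj (fun c => ?_) ?_
    · have := congrArg (Polynomial.eval (C c * X 0)) (Polynomial.modByMonic_add_div (e q) N)
      simpa [hNroot, hroot] using this
    · rw [ZMod.card]
      have h := Polynomial.degree_modByMonic_lt (e q) hN
      rw [hNdeg] at h
      by_cases hz : (e q) %ₘ N = 0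
      · rw [hz]; simp; omega
      · exact (Polynomial.natDegree_lt_iff_degree_lt hz).2 h
  obtain ⟨t, ht⟩ := (Polynomial.modByMonic_eq_zero_iff_dvd hN).1 hr
  refine ⟨e.symm t, e.injective ?_⟩
  have h1 : (X 0 : MvPolynomial (Fin 1) (ZMod p)) ^ (p - 1) * X 0 = X 0 ^ p := by
    rw [← pow_succ, Nat.sub_add_cancel (by omega)]
  have h2 := congrArg Polynomial.C h1
  rw [Polynomial.C_mul, Polynomial.C_pow (n := p)] at h2
  simp only [dicksonF, map_mul, map_sub, map_pow, he0, he1, ht, N, AlgEquiv.apply_symm_apply]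
  rw [Polynomial.C_pow] at h2
  linear_combination (-Polynomial.X * t) * h2

lemma pderiv_one_subst_transvection (M : Matrix.SpecialLinearGroup (Fin 2) (ZMod p))
    (hM : M.1 = !![1, 0; 1, 1]) (g : MvPolynomial (Fin 2) (ZMod p)) :
    pderiv 1 (subst M g) = subst M (pderiv 0 g) + subst M (pderiv 1 g) := by
  induction g using MvPolynomial.induction_on with
  | C c => simp
  | add g₁ g₂ h₁ h₂ => simp only [map_add, h₁, h₂]; ring
  | mul_X g i h =>
    fin_cases i <;> simp [h, hM, pderiv_X] <;> ring

lemma restrict_subst_transvection (M : Matrix.SpecialLinearGroup (Fin 2) (ZMod p))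
    (hM : M.1 = !![1, 0; 1, 1]) (g : MvPolynomial (Fin 2) (ZMod p)) :
    restrict p (subst M g) = restrict p g := by
  have : (restrict p).comp (subst M) = restrict p := by
    ext i : 1
    fin_cases i <;> simp [hM]
  exact DFunLike.congr_fun this g

lemma derivative_restrict (g : MvPolynomial (Fin 2) (ZMod p)) :
    Polynomial.derivative (restrict p g) = restrict p (pderiv 0 g) := by
  induction g using MvPolynomial.induction_on with
  | C c => simp
  | add g₁ g₂ h₁ h₂ => simp only [map_add, h₁, h₂]
  | mul_X g i h =>
    fin_cases i <;> simp [h, pderiv_X]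
    ring

lemma derivative_restrict_eq_zero {g : MvPolynomial (Fin 2) (ZMod p)}
    (hg : ∀ M, subst M g = g) : Polynomial.derivative (restrict p g) = 0 := by
  let M : Matrix.SpecialLinearGroup (Fin 2) (ZMod p) :=
    ⟨!![1, 0; 1, 1], by simp [Matrix.det_fin_two]⟩
  have h := congrArg (restrict p) (pderiv_one_subst_transvection M rfl g)
  rw [hg, map_add, restrict_subst_transvection M rfl, restrict_subst_transvection M rfl] at h
  rw [derivative_restrict]
  simpa using h

lemma restrict_subst_diagonal (M : Matrix.SpecialLinearGroup (Fin 2) (ZMod p)) (t u : ZMod p)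
    (hM : M.1 = !![t, 0; 0, u]) (g : MvPolynomial (Fin 2) (ZMod p)) :
    restrict p (subst M g) = (restrict p g).comp (Polynomial.C t * Polynomial.X) := by
  induction g using MvPolynomial.induction_on with
  | C c => simp
  | add g₁ g₂ h₁ h₂ => simp only [map_add, h₁, h₂, Polynomial.add_comp]
  | mul_X g i h =>
    fin_cases i <;> simp [h, hM]

/-- On the line `η = 0`, an invariant is a polynomial in `ξ ^ (p (p - 1))`. -/
lemma dvd_of_coeff_restrict_ne_zero {g : MvPolynomial (Fin 2) (ZMod p)}
    (hg : ∀ M, subst M g = g) {n : ℕ} (hn : (restrict p g).coeff n ≠ 0) : p * (p - 1) ∣ n := by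
  have hp := (Fact.out : p.Prime)
  have hp2 := hp.two_le
  have h1 : p ∣ n := by
    have h := Polynomial.expand_contract p (derivative_restrict_eq_zero hg) hp.ne_zero
    rw [← h, Polynomial.coeff_expand hp.pos] at hn
    by_contra hc
    simp [hc] at hn
  have h2 : p - 1 ∣ n := by
    have := FiniteField.forall_pow_eq_one_iff (ZMod p) n
    rw [ZMod.card] at this
    rw [← this]
    intro t
    obtain ⟨M, hM⟩ : ∃ M : Matrix.SpecialLinearGroup (Fin 2) (ZMod p),
        M.1 = !![(t : ZMod p), 0; 0, ((t⁻¹ : (ZMod p)ˣ) : ZMod p)] :=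
      ⟨⟨_, by rw [Matrix.det_fin_two_of, Units.mul_inv, mul_zero, sub_zero]⟩, rfl⟩
    have hc := congrArg (fun q => Polynomial.coeff q n) (restrict_subst_diagonal M _ _ hM g)
    rw [hg] at hc
    simp only [Polynomial.comp_C_mul_X_coeff] at hc
    apply Units.ext
    push_cast
    exact mul_left_cancel₀ hn (by rw [mul_one]; exact hc.symm)
  refine Nat.Coprime.mul_dvd_of_dvd_of_dvd ?_ h1 h2
  exact (Nat.coprime_self_sub_right hp.one_le).2 (Nat.coprime_one_right p)

lemma restrict_dicksonH : restrict p (dicksonH p) = Polynomial.X ^ (p * (p - 1)) := by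
  have hp := (Fact.out : p.Prime).two_le
  have : p ^ 2 - p = p * (p - 1) := by rw [Nat.mul_sub, sq, mul_one]
  simp [dicksonH, this, show p - 1 ≠ 0 by omega]

lemma totalDegree_dicksonH_le : (dicksonH p).totalDegree ≤ p * (p - 1) := by
  have hp := (Fact.out : p.Prime).two_le
  have e : p ^ 2 - p = p * (p - 1) := by rw [Nat.mul_sub, sq, mul_one]
  have e' : (p - 1) + (p - 1) * (p - 1) = p * (p - 1) := by
    obtain ⟨k, rfl⟩ : ∃ k, p = k + 1 := ⟨p - 1, by omega⟩
    simp; ring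
  refine (totalDegree_add _ _).trans (max_le ?_ ?_)
  · rw [totalDegree_X_pow, e]
  · refine (totalDegree_mul _ _).trans ?_
    rw [← e']
    refine add_le_add (totalDegree_X_pow _ _).le ((totalDegree_pow _ _).trans
      (Nat.mul_le_mul_left _ ?_))
    refine (totalDegree_sub _ _).trans ?_
    simp [totalDegree_X_pow]

lemma exists_mul_dicksonF {g : MvPolynomial (Fin 2) (ZMod p)}
    (hg : ∀ M, subst M g = g) (h0 : restrict p g = 0) :
    ∃ q, g = dicksonF p * q ∧ ∀ M, subst M q = q := by
  obtain ⟨q, rfl⟩ := dicksonF_dvd_of_restrict_eq_zero hg h0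
  refine ⟨q, rfl, fun M => mul_left_cancel₀ (dicksonF_ne_zero (p := p)) ?_⟩
  simpa [subst_dicksonF] using hg M

/-- **Dickson's theorem** for `SL₂(𝔽_p)`. -/
theorem mem_adjoin_of_forall_subst_eq (g : MvPolynomial (Fin 2) (ZMod p))
    (hg : ∀ M, subst M g = g) : g ∈ Algebra.adjoin (ZMod p) {dicksonF p, dicksonH p} := by
  have hp := (Fact.out : p.Prime).two_le
  have hpos : 0 < p * (p - 1) := Nat.mul_pos (by omega) (by omega)
  induction hd : g.totalDegree using Nat.strong_induction_on generalizing g with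
  | _ d ih =>
  obtain ⟨r, hr⟩ : ∃ r : Polynomial (ZMod p),
      Polynomial.expand (ZMod p) (p * (p - 1)) r = restrict p g := by
    refine ⟨Polynomial.contract (p * (p - 1)) (restrict p g), ?_⟩
    ext n
    rw [Polynomial.coeff_expand hpos, Polynomial.coeff_contract hpos.ne']
    split_ifs with h
    · rw [Nat.div_mul_cancel h]
    · by_contra hc
      exact h (dvd_of_coeff_restrict_ne_zero hg (Ne.symm hc))
  have hF : dicksonF p ∈ Algebra.adjoin (ZMod p) {dicksonF p, dicksonH p} :=
    Algebra.subset_adjoin (by simp)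
  have hH : dicksonH p ∈ Algebra.adjoin (ZMod p) {dicksonF p, dicksonH p} :=
    Algebra.subset_adjoin (by simp)
  have hrH : Polynomial.aeval (dicksonH p) r ∈ Algebra.adjoin (ZMod p) {dicksonF p, dicksonH p} :=
    Algebra.adjoin_mono (by simp) (Polynomial.aeval_mem_adjoin_singleton (ZMod p) (dicksonH p))
  obtain ⟨q, hq, hqinv⟩ := exists_mul_dicksonF (g := g - Polynomial.aeval (dicksonH p) r)
    (fun M => by rw [map_sub, hg, ← Polynomial.aeval_algHom_apply, subst_dicksonH])
    (by rw [map_sub, ← Polynomial.aeval_algHom_apply, restrict_dicksonH, ← hr,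
      Polynomial.expand_eq_comp_X_pow, Polynomial.comp_eq_aeval, sub_self])
  rw [← sub_add_cancel g (Polynomial.aeval (dicksonH p) r), hq]
  refine add_mem (mul_mem hF ?_) hrH
  rcases eq_or_ne q 0 with rfl | hq0
  · exact zero_mem _
  refine ih _ ?_ q hqinv rfl
  have hdegr : (Polynomial.aeval (dicksonH p) r).totalDegree ≤ d := by
    have h1 : r.natDegree * (p * (p - 1)) ≤ d := by
      rw [← Polynomial.natDegree_expand, hr]
      refine (aeval_natDegree_le g hd.le _ (n := 1) fun i => ?_).trans_eq (mul_one d)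
      fin_cases i <;> simp
    rw [Polynomial.aeval_eq_sum_range]
    refine totalDegree_finsetSum_le fun i hi => ?_
    refine (totalDegree_smul_le _ _).trans ((totalDegree_pow _ _).trans ?_)
    refine le_trans (Nat.mul_le_mul ?_ totalDegree_dicksonH_le) h1
    exact Nat.lt_succ_iff.1 (Finset.mem_range.1 hi)
  have hle : (dicksonF p * q).totalDegree ≤ d := by
    rw [← hq]
    exact (totalDegree_sub _ _).trans (max_le hd.le hdegr)
  rw [totalDegree_mul_of_isDomain dicksonF_ne_zero hq0] at hle
  have hFdeg : (dicksonF p).totalDegree ≠ 0 := by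
    intro h
    rw [totalDegree_eq_zero_iff_eq_C] at h
    have h2 := congrArg (restrict p) h
    have h3 : restrict p (dicksonF p) = 0 := by simp [dicksonF, show p ≠ 0 by omega]
    rw [h3, restrict_C] at h2
    rw [Polynomial.C_eq_zero.1 h2.symm, C_0] at h
    exact dicksonF_ne_zero h
  omega

/-- Invariants `A`, `B` with `ξ ^ p A = ξ B` on the line `η = 0` vanish on that line. -/
lemma restrict_eq_zero_of_mul_eq {A B : MvPolynomial (Fin 2) (ZMod p)}
    (hA : ∀ M, subst M A = A) (hB : ∀ M, subst M B = B)
    (h : Polynomial.X ^ p * restrict p A = Polynomial.X * restrict p B) :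
    restrict p A = 0 ∧ restrict p B = 0 := by
  have hp := (Fact.out : p.Prime).two_le
  have hA0 : restrict p A = 0 := by
    ext n
    by_contra hn
    rw [Polynomial.coeff_zero] at hn
    have hd := dvd_of_coeff_restrict_ne_zero hA hn
    have hc := congrArg (fun q => Polynomial.coeff q (n + (p - 1) + 1)) h
    simp only [Polynomial.coeff_X_mul] at hc
    rw [show n + (p - 1) + 1 = n + p by omega, Polynomial.coeff_X_pow_mul] at hc
    have hd' := dvd_of_coeff_restrict_ne_zero hB (hc ▸ hn)
    have h3 := Nat.le_of_dvd (by omega) ((Nat.dvd_add_right hd).1 hd')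
    nlinarith [Nat.mul_le_mul_right (p - 1) hp, (show 0 < p - 1 by omega)]
  refine ⟨hA0, ?_⟩
  rw [hA0, mul_zero] at h
  exact (mul_eq_zero.1 h.symm).resolve_left Polynomial.X_ne_zero

end Polynomial

section Exterior

variable (p : ℕ)

/-- The exterior algebra `Λ[a, b]` over `𝔽_p`. -/
abbrev Ext : Type := ExteriorAlgebra (ZMod p) (Fin 2 → ZMod p)

/-- The generator `a`. -/
noncomputable def extA : Ext p := ExteriorAlgebra.ι (ZMod p) (Pi.single 0 1)

/-- The generator `b`. -/
noncomputable def extB : Ext p := ExteriorAlgebra.ι (ZMod p) (Pi.single 1 1)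

lemma extA_mul_extA : extA p * extA p = 0 := ExteriorAlgebra.ι_sq_zero _

lemma extB_mul_extB : extB p * extB p = 0 := ExteriorAlgebra.ι_sq_zero _

lemma extB_mul_extA : extB p * extA p = -(extA p * extB p) :=
  eq_neg_of_add_eq_zero_left (ExteriorAlgebra.ι_add_mul_swap _ _)

lemma ι_eq (v : Fin 2 → ZMod p) :
    ExteriorAlgebra.ι (ZMod p) v = v 0 • extA p + v 1 • extB p := by
  rw [extA, extB, ← map_smul, ← map_smul, ← map_add]
  congr 1
  ext i
  fin_cases i <;> simp

/-- The degenerate quaternion algebra with `i² = j² = 0` has the multiplication table of the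
exterior algebra on two generators. -/
noncomputable def extToQuaternion (R : Type*) [CommRing R] [Algebra (ZMod p) R] :
    Ext p →ₐ[ZMod p] QuaternionAlgebra R 0 0 0 :=
  ExteriorAlgebra.lift (ZMod p)
    ⟨{ toFun := fun v => ⟨0, algebraMap _ R (v 0), algebraMap _ R (v 1), 0⟩
       map_add' := fun v w => by ext <;> simp
       map_smul' := fun c v => by ext <;> simp [← Algebra.smul_def] },
      fun v => by ext <;> simp [mul_comm]⟩

@[simp]
lemma extToQuaternion_extA (R : Type*) [CommRing R] [Algebra (ZMod p) R] :
    extToQuaternion p R (extA p) = ⟨0, 1, 0, 0⟩ := by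
  simp [extToQuaternion, extA]

@[simp]
lemma extToQuaternion_extB (R : Type*) [CommRing R] [Algebra (ZMod p) R] :
    extToQuaternion p R (extB p) = ⟨0, 0, 1, 0⟩ := by
  simp [extToQuaternion, extB]

/-- The quaternion basis `1, a, b, ab` of the exterior algebra. -/
noncomputable def extBasis : QuaternionAlgebra.Basis (Ext p) (0 : ZMod p) 0 0 where
  i := extA p
  j := extB p
  k := extA p * extB p
  i_mul_i := by simp [extA_mul_extA]
  j_mul_j := by simp [extB_mul_extB]
  i_mul_j := rfl
  j_mul_i := by simp [extB_mul_extA]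

lemma exists_ext_eq (x : Ext p) : ∃ c₀ c₁ c₂ c₃ : ZMod p,
    x = c₀ • 1 + c₁ • extA p + c₂ • extB p + c₃ • (extA p * extB p) := by
  have h : ((extBasis p).liftHom).comp (extToQuaternion p (ZMod p)) = AlgHom.id (ZMod p) _ := by
    refine ExteriorAlgebra.hom_ext (LinearMap.ext fun v => ?_)
    simp only [AlgHom.toLinearMap_apply, LinearMap.comp_apply, AlgHom.comp_apply, ι_eq p v]
    simp [QuaternionAlgebra.Basis.lift, extBasis]
  have hx := DFunLike.congr_fun h x
  refine ⟨(extToQuaternion p (ZMod p) x).re, (extToQuaternion p (ZMod p) x).imI,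
    (extToQuaternion p (ZMod p) x).imJ, (extToQuaternion p (ZMod p) x).imK, hx.symm.trans ?_⟩
  simp [QuaternionAlgebra.Basis.lift, extBasis, Algebra.algebraMap_eq_smul_one]

/-- The algebra `𝔽_p[ξ, η] ⊗ Λ[a, b]`. -/
abbrev Form : Type := MvPolynomial (Fin 2) (ZMod p) ⊗[ZMod p] Ext p

/-- The form `q₀ + q₁ a + q₂ b + q₃ ab`. -/
noncomputable def form (q₀ q₁ q₂ q₃ : MvPolynomial (Fin 2) (ZMod p)) : Form p :=
  q₀ ⊗ₜ 1 + q₁ ⊗ₜ extA p + q₂ ⊗ₜ extB p + q₃ ⊗ₜ (extA p * extB p)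

lemma exists_form_eq (g : Form p) : ∃ q₀ q₁ q₂ q₃, g = form p q₀ q₁ q₂ q₃ := by
  induction g using TensorProduct.induction_on with
  | zero => exact ⟨0, 0, 0, 0, by simp [form]⟩
  | tmul q x =>
    obtain ⟨c₀, c₁, c₂, c₃, rfl⟩ := exists_ext_eq p x
    refine ⟨c₀ • q, c₁ • q, c₂ • q, c₃ • q, ?_⟩
    simp only [form, tmul_add, smul_tmul]
  | add g₁ g₂ h₁ h₂ =>
    obtain ⟨q₀, q₁, q₂, q₃, rfl⟩ := h₁
    obtain ⟨r₀, r₁, r₂, r₃, rfl⟩ := h₂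
    refine ⟨q₀ + r₀, q₁ + r₁, q₂ + r₂, q₃ + r₃, ?_⟩
    simp only [form, add_tmul]
    abel

/-- The coordinates of a form, packaged as an algebra homomorphism. -/
noncomputable def formToQuaternion :
    Form p →ₐ[ZMod p] QuaternionAlgebra (MvPolynomial (Fin 2) (ZMod p)) 0 0 0 :=
  Algebra.TensorProduct.lift
    (IsScalarTower.toAlgHom (ZMod p) (MvPolynomial (Fin 2) (ZMod p))
      (QuaternionAlgebra (MvPolynomial (Fin 2) (ZMod p)) 0 0 0))
    (extToQuaternion p _) (fun q _ => Algebra.commutes q _)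

lemma formToQuaternion_tmul (q : MvPolynomial (Fin 2) (ZMod p)) (x : Ext p) :
    formToQuaternion p (q ⊗ₜ x) = q • extToQuaternion p _ x :=
  (Algebra.TensorProduct.lift_tmul _ _ _ _ _).trans (Algebra.smul_def _ _).symm

lemma formToQuaternion_form (q₀ q₁ q₂ q₃ : MvPolynomial (Fin 2) (ZMod p)) :
    formToQuaternion p (form p q₀ q₁ q₂ q₃) = ⟨q₀, q₁, q₂, q₃⟩ := by
  simp only [form, map_add, formToQuaternion_tmul, map_one, map_mul,
    extToQuaternion_extA, extToQuaternion_extB]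
  ext : 1 <;> simp

lemma form_inj {q₀ q₁ q₂ q₃ r₀ r₁ r₂ r₃ : MvPolynomial (Fin 2) (ZMod p)} :
    form p q₀ q₁ q₂ q₃ = form p r₀ r₁ r₂ r₃ ↔ q₀ = r₀ ∧ q₁ = r₁ ∧ q₂ = r₂ ∧ q₃ = r₃ := by
  refine ⟨fun h => ?_, by rintro ⟨rfl, rfl, rfl, rfl⟩; rfl⟩
  have := congrArg (formToQuaternion p) h
  simpa [formToQuaternion_form] using this

variable {p}

/-- The diagonal action of `M ∈ SL₂(𝔽_p)` on forms. -/
noncomputable def formAct (M : Matrix.SpecialLinearGroup (Fin 2) (ZMod p)) :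
    Form p →ₐ[ZMod p] Form p :=
  Algebra.TensorProduct.map (subst M)
    (ExteriorAlgebra.map (Matrix.toLin' (M : Matrix (Fin 2) (Fin 2) (ZMod p))))

lemma formAct_form (M : Matrix.SpecialLinearGroup (Fin 2) (ZMod p))
    (q₀ q₁ q₂ q₃ : MvPolynomial (Fin 2) (ZMod p)) :
    formAct M (form p q₀ q₁ q₂ q₃) = form p (subst M q₀)
      (M.1 0 0 • subst M q₁ + M.1 0 1 • subst M q₂)
      (M.1 1 0 • subst M q₁ + M.1 1 1 • subst M q₂) (subst M q₃) := by
  have ha : ExteriorAlgebra.map (Matrix.toLin' M.1) (extA p) =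
      M.1 0 0 • extA p + M.1 1 0 • extB p := by
    rw [extA, ExteriorAlgebra.map_apply_ι, ι_eq]
    simp [extA]
  have hb : ExteriorAlgebra.map (Matrix.toLin' M.1) (extB p) =
      M.1 0 1 • extA p + M.1 1 1 • extB p := by
    rw [extB, ExteriorAlgebra.map_apply_ι, ι_eq]
    simp [extB]
  have hab : ExteriorAlgebra.map (Matrix.toLin' M.1) (extA p * extB p) = extA p * extB p := by
    rw [map_mul, ha, hb]
    simp only [mul_add, add_mul, smul_mul_smul_comm, extA_mul_extA, extB_mul_extB, extB_mul_extA]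
    rw [smul_zero, smul_zero, zero_add, add_zero, smul_neg, neg_add_eq_sub, ← sub_smul,
      mul_comm (M.1 1 0), det_expand, one_smul]
  simp only [formAct, form, map_add, Algebra.TensorProduct.map_tmul, map_one, ha, hb, hab,
    tmul_add, add_tmul, smul_tmul]
  abel

lemma formAct_form_eq_iff (M : Matrix.SpecialLinearGroup (Fin 2) (ZMod p))
    (q₀ q₁ q₂ q₃ : MvPolynomial (Fin 2) (ZMod p)) :
    formAct M (form p q₀ q₁ q₂ q₃) = form p q₀ q₁ q₂ q₃ ↔ subst M q₀ = q₀ ∧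
      C (M.1 0 0) * subst M q₁ + C (M.1 0 1) * subst M q₂ = q₁ ∧
      C (M.1 1 0) * subst M q₁ + C (M.1 1 1) * subst M q₂ = q₂ ∧ subst M q₃ = q₃ := by
  rw [formAct_form, form_inj]
  simp only [smul_eq_C_mul]

/-- The invariant `ξ^(p^n) b - η^(p^n) a`. -/
noncomputable def linearForm (p n : ℕ) : Form p := form p 0 (-X 1 ^ p ^ n) (X 0 ^ p ^ n) 0

variable [Fact p.Prime]

lemma formAct_linearForm (M : Matrix.SpecialLinearGroup (Fin 2) (ZMod p)) (n : ℕ) :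
    formAct M (linearForm p n) = linearForm p n := by
  rw [linearForm, formAct_form_eq_iff]
  have h := C_det_expand M
  simp only [map_neg, subst_X_pow_prime, map_zero, true_and, and_true]
  constructor
  · linear_combination (-X 1 ^ p ^ n) * h
  · linear_combination (X 0 ^ p ^ n) * h

/-- Invariant 1-forms are combinations of `s` and `z` with invariant coefficients. -/
lemma exists_eq_of_linear_invariant {q₁ q₂ : MvPolynomial (Fin 2) (ZMod p)}
    (h₁ : ∀ M : Matrix.SpecialLinearGroup (Fin 2) (ZMod p),
      C (M.1 0 0) * subst M q₁ + C (M.1 0 1) * subst M q₂ = q₁)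
    (h₂ : ∀ M : Matrix.SpecialLinearGroup (Fin 2) (ZMod p),
      C (M.1 1 0) * subst M q₁ + C (M.1 1 1) * subst M q₂ = q₂) :
    ∃ A B, (∀ M, subst M A = A) ∧ (∀ M, subst M B = B) ∧
      q₁ = X 1 * B - X 1 ^ p * A ∧ q₂ = X 0 ^ p * A - X 0 * B := by
  have hp := (Fact.out : p.Prime).two_le
  have hinv (n : ℕ) (M : Matrix.SpecialLinearGroup (Fin 2) (ZMod p)) :
      subst M (X 0 ^ p ^ n * q₁ + X 1 ^ p ^ n * q₂) = X 0 ^ p ^ n * q₁ + X 1 ^ p ^ n * q₂ := by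
    rw [map_add, map_mul, map_mul, subst_X_pow_prime, subst_X_pow_prime]
    linear_combination X 0 ^ p ^ n * h₁ M + X 1 ^ p ^ n * h₂ M
  have hA := hinv 0
  have hB := hinv 1
  simp only [pow_zero, pow_one] at hA hB
  obtain ⟨hA0, hB0⟩ := restrict_eq_zero_of_mul_eq hA hB (by
    simp [show p ≠ 0 by omega]
    ring)
  obtain ⟨A, hAe, hAi⟩ := exists_mul_dicksonF hA hA0
  obtain ⟨B, hBe, hBi⟩ := exists_mul_dicksonF hB hB0
  refine ⟨A, B, hAi, hBi, mul_left_cancel₀ (dicksonF_ne_zero (p := p)) ?_,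
    mul_left_cancel₀ (dicksonF_ne_zero (p := p)) ?_⟩
  · rw [mul_sub, mul_left_comm, mul_left_comm _ (X 1 ^ p), ← hAe, ← hBe, dicksonF]
    ring
  · rw [mul_sub, mul_left_comm, mul_left_comm _ (X 0), ← hAe, ← hBe, dicksonF]
    ring

theorem forall_formAct_eq_iff_mem_adjoin (g : Form p) :
    (∀ M : Matrix.SpecialLinearGroup (Fin 2) (ZMod p), formAct M g = g) ↔ g ∈ Algebra.adjoin (ZMod p)
      {dicksonF p ⊗ₜ[ZMod p] (1 : Ext p), dicksonH p ⊗ₜ[ZMod p] (1 : Ext p), linearForm p 0,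
        (1 : MvPolynomial (Fin 2) (ZMod p)) ⊗ₜ[ZMod p] (extA p * extB p), linearForm p 1} := by
  constructor
  · intro hg
    set W := Algebra.adjoin (ZMod p)
      {dicksonF p ⊗ₜ[ZMod p] (1 : Ext p), dicksonH p ⊗ₜ[ZMod p] (1 : Ext p), linearForm p 0,
        (1 : MvPolynomial (Fin 2) (ZMod p)) ⊗ₜ[ZMod p] (extA p * extB p), linearForm p 1}
    have hf : dicksonF p ⊗ₜ 1 ∈ W := Algebra.subset_adjoin (by simp)
    have hh : dicksonH p ⊗ₜ 1 ∈ W := Algebra.subset_adjoin (by simp)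
    have hs : linearForm p 0 ∈ W := Algebra.subset_adjoin (by simp)
    have hy : 1 ⊗ₜ (extA p * extB p) ∈ W := Algebra.subset_adjoin (by simp)
    have hz : linearForm p 1 ∈ W := Algebra.subset_adjoin (by simp)
    have hpoly {q : MvPolynomial (Fin 2) (ZMod p)} (hq : ∀ M, subst M q = q) : q ⊗ₜ 1 ∈ W := by
      have hle : Algebra.adjoin (ZMod p) {dicksonF p, dicksonH p} ≤
          W.comap Algebra.TensorProduct.includeLeft := by
        rw [Algebra.adjoin_le_iff]
        rintro _ (rfl | rfl)
        exacts [hf, hh]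
      exact hle (mem_adjoin_of_forall_subst_eq q hq)
    obtain ⟨q₀, q₁, q₂, q₃, rfl⟩ := exists_form_eq p g
    simp only [formAct_form_eq_iff] at hg
    obtain ⟨A, B, hA, hB, rfl, rfl⟩ := exists_eq_of_linear_invariant
      (fun M => (hg M).2.1) (fun M => (hg M).2.2.1)
    have e : form p q₀ (X 1 * B - X 1 ^ p * A) (X 0 ^ p * A - X 0 * B) q₃ =
        q₀ ⊗ₜ 1 + A ⊗ₜ 1 * linearForm p 1 - B ⊗ₜ 1 * linearForm p 0 +
          q₃ ⊗ₜ 1 * 1 ⊗ₜ (extA p * extB p) := by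
      simp only [form, linearForm, mul_add, Algebra.TensorProduct.tmul_mul_tmul, one_mul, mul_one,
        zero_tmul, pow_zero, pow_one, zero_add, add_zero, mul_neg, mul_comm (X 1) B,
        mul_comm (X 0) B, mul_comm (X 1 ^ p) A, mul_comm (X 0 ^ p) A]
      simp only [sub_tmul, neg_tmul]
      abel
    rw [e]
    exact add_mem (sub_mem (add_mem (hpoly fun M => (hg M).1) (mul_mem (hpoly hA) hz))
      (mul_mem (hpoly hB) hs)) (mul_mem (hpoly fun M => (hg M).2.2.2) hy)
  · intro hg M
    have hle : Algebra.adjoin (ZMod p)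
        {dicksonF p ⊗ₜ[ZMod p] (1 : Ext p), dicksonH p ⊗ₜ[ZMod p] (1 : Ext p), linearForm p 0,
          (1 : MvPolynomial (Fin 2) (ZMod p)) ⊗ₜ[ZMod p] (extA p * extB p), linearForm p 1} ≤
        AlgHom.equalizer (formAct M) (AlgHom.id _ _) := by
      rw [Algebra.adjoin_le_iff]
      rintro _ (rfl | rfl | rfl | rfl | rfl)
      · simp [formAct, subst_dicksonF]
      · simp [formAct, subst_dicksonH]
      · exact formAct_linearForm M 0
      · have := formAct_form M 0 0 0 1
        simpa [form] using this
      · exact formAct_linearForm M 1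
    exact hle hg

end Exterior

end MuiInvariants

set_option maxHeartbeats 1000000 in
/-- Mùi's theorem for `n = 2`: an element `g` of
`A = 𝔽_p[ξ,η] ⊗ Λ_{𝔽_p}[a,b]` is invariant under the diagonal
`SL₂(𝔽_p)`-action (the linear substitution `ξ ↦ M₁₁ξ + M₂₁η, η ↦ M₁₂ξ + M₂₂η`
on the polynomial generators and the same substitution on the exterior
generators) iff `g` lies in the subalgebra generated by
`f = (ξ^pη − η^pξ)⊗1`, `h = (ξ^{p²−p} + η^{p−1}(ξ^{p−1}−η^{p−1})^{p−1})⊗1`,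
`s = ξ⊗b − η⊗a`, `y = 1⊗ab`, and `z = ξ^p⊗b − η^p⊗a`. -/
theorem mui_invariants (p : ℕ) (hp : p.Prime) (hodd : Odd p)
    (act : Matrix.SpecialLinearGroup (Fin 2) (ZMod p) →
      (MvPolynomial (Fin 2) (ZMod p) ⊗[ZMod p]
        ExteriorAlgebra (ZMod p) (Fin 2 → ZMod p)) →ₐ[ZMod p]
      (MvPolynomial (Fin 2) (ZMod p) ⊗[ZMod p]
        ExteriorAlgebra (ZMod p) (Fin 2 → ZMod p)))
    (hact : ∀ M, act M = Algebra.TensorProduct.map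
      (aeval (fun i : Fin 2 =>
        ∑ j : Fin 2, C ((M : Matrix (Fin 2) (Fin 2) (ZMod p)) j i) * X j))
      (ExteriorAlgebra.map (Matrix.toLin' (M : Matrix (Fin 2) (Fin 2) (ZMod p)))))
    (a b : ExteriorAlgebra (ZMod p) (Fin 2 → ZMod p))
    (ha : a = ExteriorAlgebra.ι (ZMod p) (Pi.single 0 1))
    (hb : b = ExteriorAlgebra.ι (ZMod p) (Pi.single 1 1))
    (f h s y z : MvPolynomial (Fin 2) (ZMod p) ⊗[ZMod p]
      ExteriorAlgebra (ZMod p) (Fin 2 → ZMod p))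
    (hf : f = (X 0 ^ p * X 1 - X 1 ^ p * X 0) ⊗ₜ[ZMod p] 1)
    (hh : h = (X 0 ^ (p ^ 2 - p)
      + X 1 ^ (p - 1) * (X 0 ^ (p - 1) - X 1 ^ (p - 1)) ^ (p - 1)) ⊗ₜ[ZMod p] 1)
    (hs : s = (X 0 : MvPolynomial (Fin 2) (ZMod p)) ⊗ₜ[ZMod p] b
      - (X 1 : MvPolynomial (Fin 2) (ZMod p)) ⊗ₜ[ZMod p] a)
    (hy : y = (1 : MvPolynomial (Fin 2) (ZMod p)) ⊗ₜ[ZMod p] (a * b))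
    (hz : z = (X 0 ^ p : MvPolynomial (Fin 2) (ZMod p)) ⊗ₜ[ZMod p] b
      - (X 1 ^ p : MvPolynomial (Fin 2) (ZMod p)) ⊗ₜ[ZMod p] a)
    (g : MvPolynomial (Fin 2) (ZMod p) ⊗[ZMod p]
      ExteriorAlgebra (ZMod p) (Fin 2 → ZMod p)) :
    (∀ M, act M g = g) ↔ g ∈ Algebra.adjoin (ZMod p) {f, h, s, y, z} := by
  have := Fact.mk hp
  have hact' : ∀ M, act M = MuiInvariants.formAct M := hact
  subst ha hb hf hh hs hy hz
  have hlin (n : ℕ) : MuiInvariants.linearForm p n =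
      (X 0 ^ p ^ n) ⊗ₜ MuiInvariants.extB p - (X 1 ^ p ^ n) ⊗ₜ MuiInvariants.extA p := by
    simp only [MuiInvariants.linearForm, MuiInvariants.form, zero_tmul, neg_tmul]
    abel
  have h := MuiInvariants.forall_formAct_eq_iff_mem_adjoin g
  rw [hlin, hlin, pow_zero, pow_one, pow_one, pow_one] at h
  simp only [hact']
  exact h
end

section
/- Each of the elements f, h, s, y, z, w of A is fixed by the action of every matrix M ∈ SL_2(𝔽_p). -/
open MvPolynomial TensorProduct

/-- The substitution `X i ↦ ∑ j, M j i • X j` of the polynomial ring attached to a matrix. -/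
noncomputable def linearSubst {R : Type*} [CommRing R] (M : Matrix (Fin 2) (Fin 2) R) :
    MvPolynomial (Fin 2) R →ₐ[R] MvPolynomial (Fin 2) R :=
  aeval (fun i : Fin 2 => ∑ j : Fin 2, C (M j i) * X j)

lemma linearSubst_X_pow {p : ℕ} [Fact p.Prime] (M : Matrix (Fin 2) (Fin 2) (ZMod p))
    (k : ℕ) (i : Fin 2) :
    linearSubst M (X i ^ p ^ k) = C (M 0 i) * X 0 ^ p ^ k + C (M 1 i) * X 1 ^ p ^ k := by
  rw [map_pow, linearSubst, aeval_X, Fin.sum_univ_two, add_pow_char_pow, mul_pow, mul_pow,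
    ← C_pow, ← C_pow, ZMod.pow_card_pow, ZMod.pow_card_pow]

lemma C_det_fin_two {R : Type*} [CommRing R] (M : Matrix.SpecialLinearGroup (Fin 2) R) :
    (C (M.1 0 0) * C (M.1 1 1) - C (M.1 0 1) * C (M.1 1 0) : MvPolynomial (Fin 2) R) = 1 := by
  rw [← C_mul, ← C_mul, ← C_sub, ← Matrix.det_fin_two, M.2, C_1]

lemma linearSubst_dickson {p : ℕ} [Fact p.Prime] (M : Matrix.SpecialLinearGroup (Fin 2) (ZMod p))
    (k : ℕ) :
    linearSubst M.1 (X 0 ^ p ^ k * X 1 - X 1 ^ p ^ k * X 0) =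
      X 0 ^ p ^ k * X 1 - X 1 ^ p ^ k * X 0 := by
  have hX (i : Fin 2) : linearSubst M.1 (X i) = C (M.1 0 i) * X 0 + C (M.1 1 i) * X 1 := by
    simpa using linearSubst_X_pow M.1 0 i
  rw [map_sub, map_mul, map_mul, linearSubst_X_pow, linearSubst_X_pow, hX, hX]
  linear_combination (X 0 ^ p ^ k * X 1 - X 1 ^ p ^ k * X 0) * C_det_fin_two M

lemma dickson_mul {p : ℕ} [Fact p.Prime] {R : Type*} [CommRing R] [CharP R p] (x y : R) :
    (x ^ p * y - y ^ p * x) *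
        (x ^ (p ^ 2 - p) + y ^ (p - 1) * (x ^ (p - 1) - y ^ (p - 1)) ^ (p - 1)) =
      x ^ p ^ 2 * y - y ^ p ^ 2 * x := by
  obtain ⟨n, hn⟩ : ∃ n, p = n + 1 := ⟨p - 1, (Nat.sub_add_cancel (Fact.out : p.Prime).pos).symm⟩
  have key := sub_pow_char (p := p) (x ^ n) (y ^ n)
  have e : p ^ 2 - p = n * p := by subst hn; rw [Nat.sub_eq_iff_eq_add (by nlinarith)]; ring
  have e2 : p ^ 2 = n * p + n + 1 := by subst hn; ring
  rw [e, e2]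
  rw [← pow_mul, ← pow_mul] at key
  have e3 : p - 1 = n := by omega
  rw [e3]
  have hp (t : R) : t ^ p = t ^ n * t := by rw [hn, pow_succ]
  rw [hp] at key
  rw [hp x, hp y]
  linear_combination x * y ^ (n + 1) * key

lemma frobenius_sub_ne_zero {p : ℕ} [Fact p.Prime] :
    (X 0 ^ p * X 1 - X 1 ^ p * X 0 : MvPolynomial (Fin 2) (ZMod p)) ≠ 0 := by
  intro h
  have hp : p.Prime := Fact.out
  have := congrArg (aeval (![Polynomial.X, 1] : Fin 2 → Polynomial (ZMod p))) h
  simp only [map_sub, map_mul, map_pow, aeval_X, map_zero, Matrix.cons_val_zero,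
    Matrix.cons_val_one, mul_one, one_pow, one_mul] at this
  exact FiniteField.X_pow_card_sub_X_ne_zero (ZMod p) hp.one_lt this

lemma linearSubst_dickson_quotient {p : ℕ} [Fact p.Prime]
    (M : Matrix.SpecialLinearGroup (Fin 2) (ZMod p)) :
    linearSubst M.1 (X 0 ^ (p ^ 2 - p)
      + X 1 ^ (p - 1) * (X 0 ^ (p - 1) - X 1 ^ (p - 1)) ^ (p - 1)) =
      X 0 ^ (p ^ 2 - p) + X 1 ^ (p - 1) * (X 0 ^ (p - 1) - X 1 ^ (p - 1)) ^ (p - 1) := by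
  apply mul_left_cancel₀ (frobenius_sub_ne_zero (p := p))
  have h1 := linearSubst_dickson M 1
  rw [pow_one] at h1
  nth_rewrite 1 [← h1]
  rw [← map_mul, dickson_mul, linearSubst_dickson]

lemma exteriorMap_ι_single {R : Type*} [CommRing R] (M : Matrix (Fin 2) (Fin 2) R) (i : Fin 2) :
    ExteriorAlgebra.map (Matrix.toLin' M) (ExteriorAlgebra.ι R (Pi.single i 1)) =
      M 0 i • ExteriorAlgebra.ι R (Pi.single 0 1) +
        M 1 i • ExteriorAlgebra.ι R (Pi.single 1 1) := by
  rw [ExteriorAlgebra.map_apply_ι, ← map_smul, ← map_smul, ← map_add]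
  congr 1
  ext j
  fin_cases j <;> simp

lemma map_tmul_sub_tmul {p : ℕ} [Fact p.Prime] (M : Matrix.SpecialLinearGroup (Fin 2) (ZMod p))
    (k : ℕ) :
    Algebra.TensorProduct.map (linearSubst M.1) (ExteriorAlgebra.map (Matrix.toLin' M.1))
        ((X 0 ^ p ^ k) ⊗ₜ[ZMod p] ExteriorAlgebra.ι (ZMod p) (Pi.single 1 1) -
          (X 1 ^ p ^ k) ⊗ₜ[ZMod p] ExteriorAlgebra.ι (ZMod p) (Pi.single 0 1)) =
      (X 0 ^ p ^ k) ⊗ₜ[ZMod p] ExteriorAlgebra.ι (ZMod p) (Pi.single 1 1) -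
        (X 1 ^ p ^ k) ⊗ₜ[ZMod p] ExteriorAlgebra.ι (ZMod p) (Pi.single 0 1) := by
  have hdet : M.1 0 0 * M.1 1 1 - M.1 0 1 * M.1 1 0 = 1 := by rw [← Matrix.det_fin_two, M.2]
  simp only [map_sub, Algebra.TensorProduct.map_tmul, linearSubst_X_pow, exteriorMap_ι_single,
    C_mul', TensorProduct.add_tmul, TensorProduct.tmul_add, TensorProduct.tmul_smul,
    ← TensorProduct.smul_tmul']
  trans (M.1 0 0 * M.1 1 1 - M.1 0 1 * M.1 1 0) • ((X 0 ^ p ^ k : MvPolynomial (Fin 2) (ZMod p)) ⊗ₜ[ZMod p]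
      ExteriorAlgebra.ι (ZMod p) (Pi.single 1 1) -
    (X 1 ^ p ^ k) ⊗ₜ[ZMod p] ExteriorAlgebra.ι (ZMod p) (Pi.single 0 1))
  · module
  · rw [hdet, one_smul]

lemma exteriorMap_ι_mul_ι {R : Type*} [CommRing R] (M : Matrix.SpecialLinearGroup (Fin 2) R) :
    ExteriorAlgebra.map (Matrix.toLin' M.1)
        (ExteriorAlgebra.ι R (Pi.single 0 1) * ExteriorAlgebra.ι R (Pi.single 1 1)) =
      ExteriorAlgebra.ι R (Pi.single 0 1) * ExteriorAlgebra.ι R (Pi.single 1 1) := by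
  have hdet : M.1 0 0 * M.1 1 1 - M.1 0 1 * M.1 1 0 = 1 := by rw [← Matrix.det_fin_two, M.2]
  have hanti := eq_neg_of_add_eq_zero_right (ExteriorAlgebra.ι_add_mul_swap (R := R)
    (Pi.single 0 1 : Fin 2 → R) (Pi.single 1 1))
  rw [map_mul, exteriorMap_ι_single, exteriorMap_ι_single]
  simp only [mul_add, add_mul, smul_mul_smul_comm, ExteriorAlgebra.ι_sq_zero, smul_zero, hanti]
  trans (M.1 0 0 * M.1 1 1 - M.1 0 1 * M.1 1 0) • (ExteriorAlgebra.ι R (Pi.single 0 1 : Fin 2 → R) *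
    ExteriorAlgebra.ι R (Pi.single 1 1))
  · module
  · rw [hdet, one_smul]

set_option maxHeartbeats 1000000 in
/-- Each of the elements `f ⊗ 1`, `h ⊗ 1`, `s = ξ⊗b − η⊗a`, `y = 1⊗ab`,
`z = ξ^p⊗b − η^p⊗a`, `w = ξ^{p²}⊗b − η^{p²}⊗a` of
`A = 𝔽_p[ξ,η] ⊗ Λ_{𝔽_p}[a,b]` is fixed by the diagonal `SL₂(𝔽_p)`-action
(by the linear substitution `ξ ↦ M₁₁ξ + M₂₁η, η ↦ M₁₂ξ + M₂₂η` on the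
polynomial generators and the same substitution on the exterior generators). -/
theorem invariant_elements (p : ℕ) (hp : p.Prime) (hodd : Odd p)
    (M : Matrix.SpecialLinearGroup (Fin 2) (ZMod p))
    (act : (MvPolynomial (Fin 2) (ZMod p) ⊗[ZMod p]
        ExteriorAlgebra (ZMod p) (Fin 2 → ZMod p)) →ₐ[ZMod p]
      (MvPolynomial (Fin 2) (ZMod p) ⊗[ZMod p]
        ExteriorAlgebra (ZMod p) (Fin 2 → ZMod p)))
    (hact : act = Algebra.TensorProduct.map
      (aeval (fun i : Fin 2 =>
        ∑ j : Fin 2, C ((M : Matrix (Fin 2) (Fin 2) (ZMod p)) j i) * X j))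
      (ExteriorAlgebra.map (Matrix.toLin' (M : Matrix (Fin 2) (Fin 2) (ZMod p)))))
    (a b : ExteriorAlgebra (ZMod p) (Fin 2 → ZMod p))
    (ha : a = ExteriorAlgebra.ι (ZMod p) (Pi.single 0 1))
    (hb : b = ExteriorAlgebra.ι (ZMod p) (Pi.single 1 1))
    (f h s y z w : MvPolynomial (Fin 2) (ZMod p) ⊗[ZMod p]
      ExteriorAlgebra (ZMod p) (Fin 2 → ZMod p))
    (hf : f = (X 0 ^ p * X 1 - X 1 ^ p * X 0) ⊗ₜ[ZMod p] 1)
    (hh : h = (X 0 ^ (p ^ 2 - p)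
      + X 1 ^ (p - 1) * (X 0 ^ (p - 1) - X 1 ^ (p - 1)) ^ (p - 1)) ⊗ₜ[ZMod p] 1)
    (hs : s = (X 0 : MvPolynomial (Fin 2) (ZMod p)) ⊗ₜ[ZMod p] b
      - (X 1 : MvPolynomial (Fin 2) (ZMod p)) ⊗ₜ[ZMod p] a)
    (hy : y = (1 : MvPolynomial (Fin 2) (ZMod p)) ⊗ₜ[ZMod p] (a * b))
    (hz : z = (X 0 ^ p : MvPolynomial (Fin 2) (ZMod p)) ⊗ₜ[ZMod p] b
      - (X 1 ^ p : MvPolynomial (Fin 2) (ZMod p)) ⊗ₜ[ZMod p] a)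
    (hw : w = (X 0 ^ (p ^ 2) : MvPolynomial (Fin 2) (ZMod p)) ⊗ₜ[ZMod p] b
      - (X 1 ^ (p ^ 2) : MvPolynomial (Fin 2) (ZMod p)) ⊗ₜ[ZMod p] a) :
    act f = f ∧ act h = h ∧ act s = s ∧ act y = y ∧ act z = z ∧ act w = w := by
  have : Fact p.Prime := ⟨hp⟩
  change act = Algebra.TensorProduct.map (linearSubst M.1)
    (ExteriorAlgebra.map (Matrix.toLin' M.1)) at hact
  subst hact ha hb hf hh hs hy hz hw
  refine ⟨?_, ?_, ?_, ?_, ?_, ?_⟩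
  · rw [Algebra.TensorProduct.map_tmul, map_one]
    congr 1
    simpa using linearSubst_dickson M 1
  · rw [Algebra.TensorProduct.map_tmul, map_one, linearSubst_dickson_quotient]
  · simpa only [pow_zero, pow_one] using map_tmul_sub_tmul M 0
  · rw [Algebra.TensorProduct.map_tmul, map_one, exteriorMap_ι_mul_ι]
  · simpa only [pow_one] using map_tmul_sub_tmul M 1
  · exact map_tmul_sub_tmul M 2
end

section
/- Let R ⊆ A be the 𝔽_p-subalgebra generated by f, h, s, y, z. Then R is isomorphic, as an 𝔽_p-algebra, to the quotient of 𝔽_p[F,H] ⊗ Λ_{𝔽_p}[S,Y,Z] (polynomial algebra on two generators F, H tensored with the exterior algebra on three generators S, Y, Z) by the two-sided ideal generated by Y·S, Y·Z, and F·Y + S·Z, via the map determined by F ↦ f, H ↦ h, S ↦ s, Y ↦ y, Z ↦ z. -/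
open MvPolynomial TensorProduct

section AlgebraicIndependence

variable {K : Type*} [Field K]

/-- Two bivariate polynomials `f ≠ 0` and `h` are algebraically independent as soon as setting the
second variable to `0` kills `f` and turns `h` into a positive power of the first variable. -/
theorem aeval_pair_injective {f h : MvPolynomial (Fin 2) K} {m : ℕ} (hm : 0 < m) (hf : f ≠ 0)
    (hf₀ : aeval ![(Polynomial.X : Polynomial K), 0] f = 0)
    (hh₀ : aeval ![(Polynomial.X : Polynomial K), 0] h = Polynomial.X ^ m) :
    Function.Injective (aeval ![f, h] : MvPolynomial (Fin 2) K →ₐ[K] MvPolynomial (Fin 2) K) := by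
  rw [injective_iff_map_eq_zero]
  intro P hP
  by_contra hP₀
  obtain ⟨k, Q, hQ, rfl⟩ := WfDvdMonoid.max_power_factor hP₀
    (X_prime (R := K) (i := (0 : Fin 2))).irreducible
  have hQ₀ : aeval ![f, h] Q = 0 := by
    simpa [hf] using hP
  have hexpand : Polynomial.expand K m (aeval ![0, Polynomial.X] Q) = 0 := by
    have hcomp : (Polynomial.expand K m).comp (aeval ![0, Polynomial.X]) =
        (aeval ![(Polynomial.X : Polynomial K), 0]).comp
          (aeval ![f, h] : MvPolynomial (Fin 2) K →ₐ[K] MvPolynomial (Fin 2) K) := by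
      ext i : 1
      fin_cases i <;> simp [hf₀, hh₀]
    have hQ₂ := DFunLike.congr_fun hcomp Q
    rwa [AlgHom.comp_apply, AlgHom.comp_apply, hQ₀, map_zero] at hQ₂
  have hQ₁ : aeval ![(0 : Polynomial K), Polynomial.X] Q = 0 :=
    (Polynomial.expand_eq_zero hm).1 hexpand
  apply hQ
  rw [← Ideal.mem_span_singleton, ← Ideal.Quotient.eq_zero_iff_mem]
  let I : Ideal (MvPolynomial (Fin 2) K) := Ideal.span {X 0}
  have hmk : Ideal.Quotient.mkₐ K I =
      ((Ideal.Quotient.mkₐ K I).comp (Polynomial.aeval (X 1))).comp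
        (aeval ![(0 : Polynomial K), Polynomial.X]) := by
    ext i : 1
    fin_cases i <;> simp [I]
  simpa [hQ₁] using DFunLike.congr_fun hmk Q

end AlgebraicIndependence

section MatrixModel

variable (K R : Type*) [CommRing K] [CommRing R] [Algebra K R]

/-- Left multiplication on the exterior algebra on `a, b`, written in the basis `1, a, b, ab`. -/
noncomputable def exteriorFinTwoToMatrix :
    ExteriorAlgebra K (Fin 2 → K) →ₐ[K] Matrix (Fin 4) (Fin 4) R :=
  ExteriorAlgebra.lift K
    ⟨Fintype.linearCombination K
      ![!![0, 0, 0, 0; 1, 0, 0, 0; 0, 0, 0, 0; 0, 0, 1, 0],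
        !![0, 0, 0, 0; 0, 0, 0, 0; 1, 0, 0, 0; 0, -1, 0, 0]], fun v => by
      simp only [Fintype.linearCombination_apply, Fin.sum_univ_two, Matrix.cons_val_zero,
        Matrix.cons_val_one, add_mul, mul_add, smul_mul_smul_comm, mul_comm (v 1) (v 0)]
      ext i j
      fin_cases i <;> fin_cases j <;> simp⟩

/-- Left multiplication on `R ⊗ Λ[a, b]`, written in the `R`-basis `1, a, b, ab`. -/
noncomputable def tensorExteriorFinTwoToMatrix :
    R ⊗[K] ExteriorAlgebra K (Fin 2 → K) →ₐ[K] Matrix (Fin 4) (Fin 4) R :=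
  Algebra.TensorProduct.lift ((Algebra.ofId R (Matrix (Fin 4) (Fin 4) R)).restrictScalars K)
    (exteriorFinTwoToMatrix K R) fun r _ => Algebra.commutes r _

variable {K R}

theorem tensorExteriorFinTwoToMatrix_tmul (r : R) (u : ExteriorAlgebra K (Fin 2 → K)) :
    tensorExteriorFinTwoToMatrix K R (r ⊗ₜ u) = r • exteriorFinTwoToMatrix K R u :=
  (Algebra.TensorProduct.lift_tmul _ _ _ _ _).trans (Algebra.smul_def _ _).symm

theorem exteriorFinTwoToMatrix_ι_zero :
    exteriorFinTwoToMatrix K R (ExteriorAlgebra.ι K (Pi.single 0 1)) =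
      !![0, 0, 0, 0; 1, 0, 0, 0; 0, 0, 0, 0; 0, 0, 1, 0] := by
  simp [exteriorFinTwoToMatrix]

theorem exteriorFinTwoToMatrix_ι_one :
    exteriorFinTwoToMatrix K R (ExteriorAlgebra.ι K (Pi.single 1 1)) =
      !![0, 0, 0, 0; 0, 0, 0, 0; 1, 0, 0, 0; 0, -1, 0, 0] := by
  simp [exteriorFinTwoToMatrix]

/-- The elements `1, a, b, ab` are linearly independent over `R` in `R ⊗ Λ[a, b]`. -/
theorem tmul_exteriorFinTwo_eq_zero {r₀ r₁ r₂ r₃ : R} {a b : ExteriorAlgebra K (Fin 2 → K)}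
    (ha : a = ExteriorAlgebra.ι K (Pi.single 0 1)) (hb : b = ExteriorAlgebra.ι K (Pi.single 1 1))
    (h : r₀ ⊗ₜ[K] 1 + r₁ ⊗ₜ[K] a + r₂ ⊗ₜ[K] b + r₃ ⊗ₜ[K] (a * b) = 0) :
    r₀ = 0 ∧ r₁ = 0 ∧ r₂ = 0 ∧ r₃ = 0 := by
  have key := congrArg (fun M => (tensorExteriorFinTwoToMatrix K R M)) h
  simp only [map_add, tensorExteriorFinTwoToMatrix_tmul, map_mul, map_one, map_zero, ha, hb,
    exteriorFinTwoToMatrix_ι_zero, exteriorFinTwoToMatrix_ι_one] at key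
  have entry (i : Fin 4) := congrFun (congrFun key i) 0
  refine ⟨?_, ?_, ?_, ?_⟩
  · simpa [Matrix.mul_apply, Fin.sum_univ_succ] using entry 0
  · simpa [Matrix.mul_apply, Fin.sum_univ_succ] using entry 1
  · simpa [Matrix.mul_apply, Fin.sum_univ_succ] using entry 2
  · simpa [Matrix.mul_apply, Fin.sum_univ_succ] using entry 3

end MatrixModel

section NormalForm

variable {K P Q : Type*} [CommRing K] [CommRing P] [Algebra K P] [Ring Q] [Algebra K Q]

/-- In a quotient of `P ⊗ Λ[S, Y, Z]` in which `YS = YZ = 0` and `SZ = -FY`, every element is a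
`P`-linear combination of `1, S, Z, Y`. -/
theorem exists_normal_form (π : P ⊗[K] ExteriorAlgebra K (Fin 3 → K) →ₐ[K] Q) (F : P)
    {S Y Z : ExteriorAlgebra K (Fin 3 → K)}
    (hS : S = ExteriorAlgebra.ι K (Pi.single 0 1)) (hY : Y = ExteriorAlgebra.ι K (Pi.single 1 1))
    (hZ : Z = ExteriorAlgebra.ι K (Pi.single 2 1))
    (hYS : π (1 ⊗ₜ (Y * S)) = 0) (hYZ : π (1 ⊗ₜ (Y * Z)) = 0)
    (hSZ : π (F ⊗ₜ Y + 1 ⊗ₜ (S * Z)) = 0) (x : P ⊗[K] ExteriorAlgebra K (Fin 3 → K)) :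
    ∃ c₀ c₁ c₂ c₃ : P, π x = π (c₀ ⊗ₜ 1 + c₁ ⊗ₜ S + c₂ ⊗ₜ Z + c₃ ⊗ₜ Y) := by
  have sq (v : Fin 3 → K) : ExteriorAlgebra.ι K v * ExteriorAlgebra.ι K v = 0 :=
    ExteriorAlgebra.ι_sq_zero v
  have anti (v w : Fin 3 → K) :
      ExteriorAlgebra.ι K v * ExteriorAlgebra.ι K w =
        -(ExteriorAlgebra.ι K w * ExteriorAlgebra.ι K v) :=
    eq_neg_of_add_eq_zero_left (ExteriorAlgebra.ι_add_mul_swap v w)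
  have scale (c d : P) (u : ExteriorAlgebra K (Fin 3 → K)) :
      π ((c * d) ⊗ₜ u) = π (c ⊗ₜ 1) * π (d ⊗ₜ u) := by
    rw [← map_mul, Algebra.TensorProduct.tmul_mul_tmul, one_mul]
  have scale_one (c : P) (u : ExteriorAlgebra K (Fin 3 → K)) :
      π (c ⊗ₜ u) = π (c ⊗ₜ 1) * π (1 ⊗ₜ u) := by
    rw [← scale, mul_one]
  have YS₀ (c : P) : π (c ⊗ₜ (Y * S)) = 0 := by rw [scale_one, hYS, mul_zero]
  have YZ₀ (c : P) : π (c ⊗ₜ (Y * Z)) = 0 := by rw [scale_one, hYZ, mul_zero]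
  have SY₀ (c : P) : π (c ⊗ₜ (S * Y)) = 0 := by
    rw [hS, hY, anti, ← hS, ← hY, tmul_neg, map_neg, YS₀, neg_zero]
  have ZY₀ (c : P) : π (c ⊗ₜ (Z * Y)) = 0 := by
    rw [hZ, hY, anti, ← hZ, ← hY, tmul_neg, map_neg, YZ₀, neg_zero]
  have SZ₀ (c : P) : π (c ⊗ₜ (S * Z)) = π ((-(c * F)) ⊗ₜ Y) := by
    have h := hSZ
    rw [map_add] at h
    rw [scale_one, eq_neg_of_add_eq_zero_right h, mul_neg, ← scale, neg_tmul, map_neg]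
  have ZS₀ (c : P) : π (c ⊗ₜ (Z * S)) = π ((c * F) ⊗ₜ Y) := by
    rw [hZ, hS, anti, ← hZ, ← hS, tmul_neg, map_neg, SZ₀, neg_tmul, map_neg, neg_neg]
  induction x using TensorProduct.induction_on with
  | zero => exact ⟨0, 0, 0, 0, by simp⟩
  | add x y hx hy =>
    obtain ⟨c₀, c₁, c₂, c₃, hc⟩ := hx
    obtain ⟨d₀, d₁, d₂, d₃, hd⟩ := hy
    refine ⟨c₀ + d₀, c₁ + d₁, c₂ + d₂, c₃ + d₃, ?_⟩
    simp only [map_add, hc, hd, add_tmul]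
    abel
  | tmul c u =>
    suffices h : ∃ c₀ c₁ c₂ c₃ : P,
        π (1 ⊗ₜ u) = π (c₀ ⊗ₜ 1 + c₁ ⊗ₜ S + c₂ ⊗ₜ Z + c₃ ⊗ₜ Y) by
      obtain ⟨c₀, c₁, c₂, c₃, h⟩ := h
      refine ⟨c * c₀, c * c₁, c * c₂, c * c₃, ?_⟩
      rw [scale_one, h]
      simp only [map_add, mul_add, scale]
    induction u using CliffordAlgebra.left_induction with
    | algebraMap r =>
      refine ⟨algebraMap K P r, 0, 0, 0, ?_⟩
      simp [Algebra.algebraMap_eq_smul_one, smul_tmul]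
    | add u v hu hv =>
      obtain ⟨c₀, c₁, c₂, c₃, hc⟩ := hu
      obtain ⟨d₀, d₁, d₂, d₃, hd⟩ := hv
      refine ⟨c₀ + d₀, c₁ + d₁, c₂ + d₂, c₃ + d₃, ?_⟩
      simp only [tmul_add, map_add, hc, hd, add_tmul]
      abel
    | ι_mul u v hu =>
      obtain ⟨c₀, c₁, c₂, c₃, hc⟩ := hu
      have hv : CliffordAlgebra.ι 0 v = v 0 • S + v 1 • Y + v 2 • Z := by
        rw [hS, hY, hZ]
        change ExteriorAlgebra.ι K v = _
        simp only [← map_smul, ← map_add]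
        congr 1
        ext i
        fin_cases i <;> simp
      refine ⟨0, v 0 • c₀, v 2 • c₀, v 0 • (-(c₂ * F)) + v 1 • c₀ + v 2 • (c₁ * F), ?_⟩
      have hmul : (1 : P) ⊗ₜ[K] (CliffordAlgebra.ι 0 v * u) =
          (1 ⊗ₜ (v 0 • S + v 1 • Y + v 2 • Z)) * (1 ⊗ₜ[K] u) := by
        rw [Algebra.TensorProduct.tmul_mul_tmul, one_mul, hv]
      have SS : S * S = 0 := by rw [hS, sq]
      have YY : Y * Y = 0 := by rw [hY, sq]
      have ZZ : Z * Z = 0 := by rw [hZ, sq]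
      rw [hmul, map_mul, hc, ← map_mul]
      simp only [tmul_add, tmul_smul, add_mul, mul_add, smul_mul_assoc,
        Algebra.TensorProduct.tmul_mul_tmul, one_mul, mul_one, SS, YY, ZZ, tmul_zero, smul_zero,
        map_add, map_smul, YS₀, YZ₀, SY₀, ZY₀, SZ₀, ZS₀, add_tmul, zero_tmul, ← smul_tmul', map_zero]
      abel

end NormalForm

open MvPolynomial TensorProduct

set_option maxHeartbeats 1000000 in
/-- The subalgebra `R` of `A = 𝔽_p[ξ,η] ⊗ Λ_{𝔽_p}[a,b]` generated by
`f, h, s, y, z` is isomorphic to the quotient of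
`B = 𝔽_p[F,H] ⊗ Λ_{𝔽_p}[S,Y,Z]` by the two-sided ideal generated by
`Y·S`, `Y·Z`, `F·Y + S·Z`, via `F ↦ f, H ↦ h, S ↦ s, Y ↦ y, Z ↦ z`.
(The quotient is realised as `RingQuot` of the relations `Y·S = 0`,
`Y·Z = 0`, `F·Y + S·Z = 0`.) -/
theorem presentation_of_R (p : ℕ) (hp : p.Prime) (hodd : Odd p)
    (a b : ExteriorAlgebra (ZMod p) (Fin 2 → ZMod p))
    (ha : a = ExteriorAlgebra.ι (ZMod p) (Pi.single 0 1))
    (hb : b = ExteriorAlgebra.ι (ZMod p) (Pi.single 1 1))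
    (f h s y z : MvPolynomial (Fin 2) (ZMod p) ⊗[ZMod p]
      ExteriorAlgebra (ZMod p) (Fin 2 → ZMod p))
    (hf : f = (X 0 ^ p * X 1 - X 1 ^ p * X 0) ⊗ₜ[ZMod p] 1)
    (hh : h = (X 0 ^ (p ^ 2 - p)
      + X 1 ^ (p - 1) * (X 0 ^ (p - 1) - X 1 ^ (p - 1)) ^ (p - 1)) ⊗ₜ[ZMod p] 1)
    (hs : s = (X 0 : MvPolynomial (Fin 2) (ZMod p)) ⊗ₜ[ZMod p] b
      - (X 1 : MvPolynomial (Fin 2) (ZMod p)) ⊗ₜ[ZMod p] a)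
    (hy : y = (1 : MvPolynomial (Fin 2) (ZMod p)) ⊗ₜ[ZMod p] (a * b))
    (hz : z = (X 0 ^ p : MvPolynomial (Fin 2) (ZMod p)) ⊗ₜ[ZMod p] b
      - (X 1 ^ p : MvPolynomial (Fin 2) (ZMod p)) ⊗ₜ[ZMod p] a)
    -- the generators `F, H, S, Y, Z` of the free graded-commutative algebra `B`
    (F H S Y Z : MvPolynomial (Fin 2) (ZMod p) ⊗[ZMod p]
      ExteriorAlgebra (ZMod p) (Fin 3 → ZMod p))
    (hF : F = (X 0 : MvPolynomial (Fin 2) (ZMod p)) ⊗ₜ[ZMod p]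
      (1 : ExteriorAlgebra (ZMod p) (Fin 3 → ZMod p)))
    (hH : H = (X 1 : MvPolynomial (Fin 2) (ZMod p)) ⊗ₜ[ZMod p]
      (1 : ExteriorAlgebra (ZMod p) (Fin 3 → ZMod p)))
    (hS : S = (1 : MvPolynomial (Fin 2) (ZMod p)) ⊗ₜ[ZMod p]
      ExteriorAlgebra.ι (ZMod p) (Pi.single 0 1))
    (hY : Y = (1 : MvPolynomial (Fin 2) (ZMod p)) ⊗ₜ[ZMod p]
      ExteriorAlgebra.ι (ZMod p) (Pi.single 1 1))
    (hZ : Z = (1 : MvPolynomial (Fin 2) (ZMod p)) ⊗ₜ[ZMod p]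
      ExteriorAlgebra.ι (ZMod p) (Pi.single 2 1))
    (rel : (MvPolynomial (Fin 2) (ZMod p) ⊗[ZMod p]
        ExteriorAlgebra (ZMod p) (Fin 3 → ZMod p)) →
      (MvPolynomial (Fin 2) (ZMod p) ⊗[ZMod p]
        ExteriorAlgebra (ZMod p) (Fin 3 → ZMod p)) → Prop)
    (hrel : rel = fun u v =>
      (u = Y * S ∧ v = 0) ∨ (u = Y * Z ∧ v = 0) ∨ (u = F * Y + S * Z ∧ v = 0)) :
    ∃ e : RingQuot rel ≃ₐ[ZMod p]
        Algebra.adjoin (ZMod p) ({f, h, s, y, z} :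
          Set (MvPolynomial (Fin 2) (ZMod p) ⊗[ZMod p]
            ExteriorAlgebra (ZMod p) (Fin 2 → ZMod p))),
      (e (RingQuot.mkAlgHom (ZMod p) rel F) : MvPolynomial (Fin 2) (ZMod p) ⊗[ZMod p]
        ExteriorAlgebra (ZMod p) (Fin 2 → ZMod p)) = f ∧
      (e (RingQuot.mkAlgHom (ZMod p) rel H) : MvPolynomial (Fin 2) (ZMod p) ⊗[ZMod p]
        ExteriorAlgebra (ZMod p) (Fin 2 → ZMod p)) = h ∧
      (e (RingQuot.mkAlgHom (ZMod p) rel S) : MvPolynomial (Fin 2) (ZMod p) ⊗[ZMod p]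
        ExteriorAlgebra (ZMod p) (Fin 2 → ZMod p)) = s ∧
      (e (RingQuot.mkAlgHom (ZMod p) rel Y) : MvPolynomial (Fin 2) (ZMod p) ⊗[ZMod p]
        ExteriorAlgebra (ZMod p) (Fin 2 → ZMod p)) = y ∧
      (e (RingQuot.mkAlgHom (ZMod p) rel Z) : MvPolynomial (Fin 2) (ZMod p) ⊗[ZMod p]
        ExteriorAlgebra (ZMod p) (Fin 2 → ZMod p)) = z := by
  have : Fact p.Prime := ⟨hp⟩
  let f₀ : MvPolynomial (Fin 2) (ZMod p) := X 0 ^ p * X 1 - X 1 ^ p * X 0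
  let h₀ : MvPolynomial (Fin 2) (ZMod p) := X 0 ^ (p ^ 2 - p)
    + X 1 ^ (p - 1) * (X 0 ^ (p - 1) - X 1 ^ (p - 1)) ^ (p - 1)
  have hf₀ : f₀ ≠ 0 := by
    intro h0
    have hX := congrArg (aeval ![(Polynomial.X : Polynomial (ZMod p)), 1]) h0
    exact FiniteField.X_pow_card_sub_X_ne_zero (ZMod p) hp.one_lt (by simpa [f₀] using hX)
  have hp1 : p - 1 ≠ 0 := Nat.sub_ne_zero_of_lt hp.one_lt
  have hp2 : 0 < p ^ 2 - p := Nat.sub_pos_of_lt (by nlinarith [hp.one_lt])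
  have hinj : Function.Injective (aeval ![f₀, h₀] :
      MvPolynomial (Fin 2) (ZMod p) →ₐ[ZMod p] MvPolynomial (Fin 2) (ZMod p)) :=
    aeval_pair_injective hp2 hf₀ (by simp [f₀, hp.ne_zero]) (by simp [h₀, hp1])
  have haa : a * a = 0 := by rw [ha]; exact ExteriorAlgebra.ι_sq_zero _
  have hbb : b * b = 0 := by rw [hb]; exact ExteriorAlgebra.ι_sq_zero _
  have hba : b * a = -(a * b) := by
    rw [ha, hb]; exact eq_neg_of_add_eq_zero_left (ExteriorAlgebra.ι_add_mul_swap _ _)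
  have haab : a * (a * b) = 0 := by rw [← mul_assoc, haa, zero_mul]
  have hbab : b * (a * b) = 0 := by
    rw [← mul_assoc, hba, neg_mul, mul_assoc, hbb, mul_zero, neg_zero]
  have haba : a * b * a = 0 := by rw [mul_assoc, hba, mul_neg, haab, neg_zero]
  have habb : a * b * b = 0 := by rw [mul_assoc, hbb, mul_zero]
  have hss : s * s = 0 := by
    simp [hs, sub_mul, mul_sub, haa, hbb, hba, tmul_neg, mul_comm]
  have hzz : z * z = 0 := by
    simp [hz, sub_mul, mul_sub, haa, hbb, hba, tmul_neg, mul_comm]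
  have hyy : y * y = 0 := by
    simp [hy, mul_assoc, hbab]
  have hys : y * s = 0 := by simp [hy, hs, mul_sub, haba, habb]
  have hsy : s * y = 0 := by simp [hy, hs, sub_mul, haab, hbab]
  have hyz : y * z = 0 := by simp [hy, hz, mul_sub, haba, habb]
  have hzy : z * y = 0 := by simp [hy, hz, sub_mul, haab, hbab]
  have hfysz : f * y + s * z = 0 := by
    simp only [hf, hy, hs, hz, sub_mul, mul_sub, haa, hbb, hba, tmul_neg, sub_tmul,
      Algebra.TensorProduct.tmul_mul_tmul, one_mul, mul_one, tmul_zero, mul_comm]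
    abel
  have hszzs : s * z + z * s = 0 := by
    simp only [hs, hz, sub_mul, mul_sub, haa, hbb, hba, tmul_neg,
      Algebra.TensorProduct.tmul_mul_tmul, tmul_zero, mul_comm]
    abel
  let θ : MvPolynomial (Fin 2) (ZMod p) →ₐ[ZMod p] MvPolynomial (Fin 2) (ZMod p) ⊗[ZMod p]
      ExteriorAlgebra (ZMod p) (Fin 2 → ZMod p) :=
    Algebra.TensorProduct.includeLeft.comp (aeval ![f₀, h₀])
  let ε : ExteriorAlgebra (ZMod p) (Fin 3 → ZMod p) →ₐ[ZMod p]
      MvPolynomial (Fin 2) (ZMod p) ⊗[ZMod p] ExteriorAlgebra (ZMod p) (Fin 2 → ZMod p) :=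
    ExteriorAlgebra.lift (ZMod p) ⟨Fintype.linearCombination (ZMod p) ![s, y, z], fun v => by
      simp only [Fintype.linearCombination_apply, Fin.sum_univ_three, Matrix.cons_val,
        add_mul, mul_add, smul_mul_smul_comm, hss, hyy, hzz, hys, hsy, hyz, hzy, smul_zero,
        eq_neg_of_add_eq_zero_right hszzs, smul_neg, mul_comm (v 2)]
      abel⟩
  let φ : MvPolynomial (Fin 2) (ZMod p) ⊗[ZMod p] ExteriorAlgebra (ZMod p) (Fin 3 → ZMod p)
      →ₐ[ZMod p] MvPolynomial (Fin 2) (ZMod p) ⊗[ZMod p]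
        ExteriorAlgebra (ZMod p) (Fin 2 → ZMod p) :=
    Algebra.TensorProduct.lift θ ε fun c u => by
      generalize ε u = w
      induction w using TensorProduct.induction_on with
      | zero => exact Commute.zero_right _
      | add x y hx hy => exact hx.add_right hy
      | tmul d v => simp [θ, Commute, SemiconjBy, mul_comm]
  have hφ (c : MvPolynomial (Fin 2) (ZMod p)) (u) : φ (c ⊗ₜ u) =
      (aeval ![f₀, h₀] c) ⊗ₜ 1 * ε u := by simp [φ, θ]
  have hεS : ε (ExteriorAlgebra.ι (ZMod p) (Pi.single 0 1)) = s := by simp [ε]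
  have hεY : ε (ExteriorAlgebra.ι (ZMod p) (Pi.single 1 1)) = y := by simp [ε]
  have hεZ : ε (ExteriorAlgebra.ι (ZMod p) (Pi.single 2 1)) = z := by simp [ε]
  have hφF : φ F = f := by simp [hF, hφ, hf, f₀]
  have hφH : φ H = h := by simp [hH, hφ, hh, h₀]
  have hφS : φ S = s := by
    rw [hS, hφ, hεS, map_one, ← Algebra.TensorProduct.one_def, one_mul]
  have hφY : φ Y = y := by
    rw [hY, hφ, hεY, map_one, ← Algebra.TensorProduct.one_def, one_mul]
  have hφZ : φ Z = z := by
    rw [hZ, hφ, hεZ, map_one, ← Algebra.TensorProduct.one_def, one_mul]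
  let ψ : RingQuot rel →ₐ[ZMod p] MvPolynomial (Fin 2) (ZMod p) ⊗[ZMod p]
      ExteriorAlgebra (ZMod p) (Fin 2 → ZMod p) :=
    RingQuot.liftAlgHom (ZMod p) ⟨φ, fun {u v} huv => by
      rw [hrel] at huv
      rcases huv with ⟨rfl, rfl⟩ | ⟨rfl, rfl⟩ | ⟨rfl, rfl⟩ <;>
        simp only [map_mul, map_add, map_zero, hφF, hφS, hφY, hφZ, hys, hyz, hfysz]⟩
  have hψ (x) : ψ (RingQuot.mkAlgHom (ZMod p) rel x) = φ x :=
    RingQuot.liftAlgHom_mkAlgHom_apply (ZMod p) _ _ x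
  have hπ {u} (hu : rel u 0) : RingQuot.mkAlgHom (ZMod p) rel u = 0 := by
    rw [RingQuot.mkAlgHom_rel (ZMod p) hu, map_zero]
  have hYS : Y * S = 1 ⊗ₜ (ExteriorAlgebra.ι (ZMod p) (Pi.single 1 1) *
      ExteriorAlgebra.ι (ZMod p) (Pi.single 0 1)) := by simp [hY, hS]
  have hYZ : Y * Z = 1 ⊗ₜ (ExteriorAlgebra.ι (ZMod p) (Pi.single 1 1) *
      ExteriorAlgebra.ι (ZMod p) (Pi.single 2 1)) := by simp [hY, hZ]
  have hFYSZ : F * Y + S * Z = X 0 ⊗ₜ ExteriorAlgebra.ι (ZMod p) (Pi.single 1 1) +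
      1 ⊗ₜ (ExteriorAlgebra.ι (ZMod p) (Pi.single 0 1) *
        ExteriorAlgebra.ι (ZMod p) (Pi.single 2 1)) := by simp [hF, hY, hS, hZ]
  have hnormal := exists_normal_form (K := ZMod p) (Q := RingQuot rel) (RingQuot.mkAlgHom (ZMod p) rel)
    (X 0 : MvPolynomial (Fin 2) (ZMod p)) rfl rfl rfl
    (hπ (by rw [hrel]; exact Or.inl ⟨hYS.symm, rfl⟩))
    (hπ (by rw [hrel]; exact Or.inr (Or.inl ⟨hYZ.symm, rfl⟩)))
    (hπ (by rw [hrel]; exact Or.inr (Or.inr ⟨hFYSZ.symm, rfl⟩)))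
  have hψinj : Function.Injective ψ := by
    rw [injective_iff_map_eq_zero]
    intro q hq
    obtain ⟨x, rfl⟩ := RingQuot.mkAlgHom_surjective (ZMod p) rel q
    obtain ⟨c₀, c₁, c₂, c₃, hc⟩ := hnormal x
    rw [hc] at hq ⊢
    rw [hψ] at hq
    simp only [map_add, hφ, hεS, hεY, hεZ, map_one, mul_one] at hq
    obtain ⟨h0, h1, h2, h3⟩ := tmul_exteriorFinTwo_eq_zero
      (r₀ := aeval ![f₀, h₀] c₀)
      (r₁ := -(aeval ![f₀, h₀] c₁ * X 1 + aeval ![f₀, h₀] c₂ * X 1 ^ p))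
      (r₂ := aeval ![f₀, h₀] c₁ * X 0 + aeval ![f₀, h₀] c₂ * X 0 ^ p)
      (r₃ := aeval ![f₀, h₀] c₃) ha hb (by
        rw [← hq, hs, hy, hz]
        simp only [mul_sub, Algebra.TensorProduct.tmul_mul_tmul, one_mul, mul_one, neg_tmul,
          add_tmul]
        abel)
    have hc1 : aeval ![f₀, h₀] c₁ = 0 :=
      (mul_eq_zero.1 (show aeval ![f₀, h₀] c₁ * f₀ = 0 by
        linear_combination -(X 0 ^ p) * h1 - X 1 ^ p * h2)).resolve_right hf₀
    have hc2 : aeval ![f₀, h₀] c₂ = 0 :=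
      (mul_eq_zero.1 (show aeval ![f₀, h₀] c₂ * f₀ = 0 by
        linear_combination X 0 * h1 + X 1 * h2)).resolve_right hf₀
    rw [(map_eq_zero_iff _ hinj).1 h0, (map_eq_zero_iff _ hinj).1 hc1,
      (map_eq_zero_iff _ hinj).1 hc2, (map_eq_zero_iff _ hinj).1 h3]
    simp
  have hrange : ψ.range = Algebra.adjoin (ZMod p) {f, h, s, y, z} := by
    apply le_antisymm
    · rintro _ ⟨q, rfl⟩
      obtain ⟨x, rfl⟩ := RingQuot.mkAlgHom_surjective (ZMod p) rel q
      obtain ⟨c₀, c₁, c₂, c₃, hc⟩ := hnormal x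
      have hθ (c : MvPolynomial (Fin 2) (ZMod p)) : (aeval ![f₀, h₀] c) ⊗ₜ 1 ∈
          Algebra.adjoin (ZMod p) {f, h, s, y, z} := by
        change θ c ∈ _
        induction c using MvPolynomial.induction_on with
        | C r => exact (MvPolynomial.algHom_C θ r).symm ▸ Subalgebra.algebraMap_mem _ r
        | add c d hc hd => rw [map_add]; exact add_mem hc hd
        | mul_X c i hc =>
          rw [map_mul]
          refine mul_mem hc (Algebra.subset_adjoin ?_)
          fin_cases i <;> simp [θ, hf, hh, f₀, h₀]
      have hs' : s ∈ Algebra.adjoin (ZMod p) {f, h, s, y, z} := Algebra.subset_adjoin (by simp)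
      have hy' : y ∈ Algebra.adjoin (ZMod p) {f, h, s, y, z} := Algebra.subset_adjoin (by simp)
      have hz' : z ∈ Algebra.adjoin (ZMod p) {f, h, s, y, z} := Algebra.subset_adjoin (by simp)
      change ψ _ ∈ _
      rw [hc, hψ]
      simp only [map_add, hφ, hεS, hεY, hεZ, map_one, mul_one]
      exact add_mem (add_mem (add_mem (hθ _) (mul_mem (hθ _) hs')) (mul_mem (hθ _) hz'))
        (mul_mem (hθ _) hy')
    · rw [Algebra.adjoin_le_iff]
      rintro _ (rfl | rfl | rfl | rfl | rfl)
      exacts [⟨_, (hψ F).trans hφF⟩, ⟨_, (hψ H).trans hφH⟩, ⟨_, (hψ S).trans hφS⟩,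
        ⟨_, (hψ Y).trans hφY⟩, ⟨_, (hψ Z).trans hφZ⟩]
  refine ⟨(AlgEquiv.ofInjective ψ hψinj).trans (Subalgebra.equivOfEq _ _ hrange),
    (hψ F).trans hφF, (hψ H).trans hφH, (hψ S).trans hφS, (hψ Y).trans hφY, (hψ Z).trans hφZ⟩
end
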